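/- arXiv:2308.00314 — 5 statements merged into one kernel-verified Lean document; each statement's English description precedes it below -/
import Mathlib

section
/- Let Ω ⊆ ℝ² be open, let f : (0,∞) → ℝ be C¹, and let (u,m) be a classical solution of the 1D MFG system with coupling f on Ω. Then at every point of Ω the quasilinear elliptic equation −u_{tt} + 2·u_x·u_{xt} − (u_x² + m·f'(m))·u_{xx} = 0 holds. -/
/-- Partial derivative in the first (space) variable. -/
noncomputable def pdx (u : ℝ → ℝ → ℝ) (x t : ℝ) : ℝ := deriv (fun y => u y t) x

/-- Partial derivative in the second (time) variable. -/
noncomputable def pdt (u : ℝ → ℝ → ℝ) (x t : ℝ) : ℝ := deriv (fun s => u x s) t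

theorem hasDerivAt_pdx {w : ℝ → ℝ → ℝ} {x t : ℝ}
    (hw : DifferentiableAt ℝ (fun p : ℝ × ℝ => w p.1 p.2) (x, t)) :
    HasDerivAt (fun y => w y t) (pdx w x t) x :=
  (hw.comp (f := fun y : ℝ => (y, t)) x (by fun_prop)).hasDerivAt

theorem hasDerivAt_pdt {w : ℝ → ℝ → ℝ} {x t : ℝ}
    (hw : DifferentiableAt ℝ (fun p : ℝ × ℝ => w p.1 p.2) (x, t)) :
    HasDerivAt (fun s => w x s) (pdt w x t) t :=
  (hw.comp (f := fun s : ℝ => (x, s)) t (by fun_prop)).hasDerivAt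

theorem pdx_eq_fderiv {w : ℝ → ℝ → ℝ} {x t : ℝ}
    (hw : DifferentiableAt ℝ (fun p : ℝ × ℝ => w p.1 p.2) (x, t)) :
    pdx w x t = fderiv ℝ (fun p : ℝ × ℝ => w p.1 p.2) (x, t) (1, 0) :=
  (hw.hasFDerivAt.comp_hasDerivAt (f := fun y : ℝ => (y, t)) x
    ((hasDerivAt_id x).prodMk (hasDerivAt_const x t))).deriv

theorem pdt_eq_fderiv {w : ℝ → ℝ → ℝ} {x t : ℝ}
    (hw : DifferentiableAt ℝ (fun p : ℝ × ℝ => w p.1 p.2) (x, t)) :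
    pdt w x t = fderiv ℝ (fun p : ℝ × ℝ => w p.1 p.2) (x, t) (0, 1) :=
  (hw.hasFDerivAt.comp_hasDerivAt (f := fun s : ℝ => (x, s)) t
    ((hasDerivAt_const t x).prodMk (hasDerivAt_id t))).deriv

section TwiceDifferentiable

variable {w : ℝ → ℝ → ℝ} {x t : ℝ}

theorem eventually_differentiableAt_uncurry
    (hw : ContDiffAt ℝ 2 (fun p : ℝ × ℝ => w p.1 p.2) (x, t)) :
    ∀ᶠ q in nhds (x, t), DifferentiableAt ℝ (fun p : ℝ × ℝ => w p.1 p.2) q :=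
  (hw.eventually (by simp)).mono fun _ hq => hq.differentiableAt (by simp)

theorem pdx_eventuallyEq_fderiv
    (hw : ContDiffAt ℝ 2 (fun p : ℝ × ℝ => w p.1 p.2) (x, t)) :
    (fun p : ℝ × ℝ => pdx w p.1 p.2) =ᶠ[nhds (x, t)]
      fun q => fderiv ℝ (fun p : ℝ × ℝ => w p.1 p.2) q (1, 0) :=
  (eventually_differentiableAt_uncurry hw).mono fun _ hq => pdx_eq_fderiv hq

theorem pdt_eventuallyEq_fderiv
    (hw : ContDiffAt ℝ 2 (fun p : ℝ × ℝ => w p.1 p.2) (x, t)) :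
    (fun p : ℝ × ℝ => pdt w p.1 p.2) =ᶠ[nhds (x, t)]
      fun q => fderiv ℝ (fun p : ℝ × ℝ => w p.1 p.2) q (0, 1) :=
  (eventually_differentiableAt_uncurry hw).mono fun _ hq => pdt_eq_fderiv hq

theorem differentiableAt_fderiv_uncurry
    (hw : ContDiffAt ℝ 2 (fun p : ℝ × ℝ => w p.1 p.2) (x, t)) :
    DifferentiableAt ℝ (fderiv ℝ (fun p : ℝ × ℝ => w p.1 p.2)) (x, t) :=
  (hw.fderiv_right (m := 1) (by norm_num)).differentiableAt (by simp)

theorem differentiableAt_pdx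
    (hw : ContDiffAt ℝ 2 (fun p : ℝ × ℝ => w p.1 p.2) (x, t)) :
    DifferentiableAt ℝ (fun p : ℝ × ℝ => pdx w p.1 p.2) (x, t) :=
  ((differentiableAt_fderiv_uncurry hw).clm_apply
    (differentiableAt_const _)).congr_of_eventuallyEq (pdx_eventuallyEq_fderiv hw)

theorem differentiableAt_pdt
    (hw : ContDiffAt ℝ 2 (fun p : ℝ × ℝ => w p.1 p.2) (x, t)) :
    DifferentiableAt ℝ (fun p : ℝ × ℝ => pdt w p.1 p.2) (x, t) :=
  ((differentiableAt_fderiv_uncurry hw).clm_apply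
    (differentiableAt_const _)).congr_of_eventuallyEq (pdt_eventuallyEq_fderiv hw)

/-- Mixed partial derivatives of a `C²` function commute. -/
theorem pdx_pdt_eq_pdt_pdx
    (hw : ContDiffAt ℝ 2 (fun p : ℝ × ℝ => w p.1 p.2) (x, t)) :
    pdx (pdt w) x t = pdt (pdx w) x t := by
  have hd := differentiableAt_fderiv_uncurry hw
  have hsymm : IsSymmSndFDerivAt ℝ (fun p : ℝ × ℝ => w p.1 p.2) (x, t) :=
    hw.isSymmSndFDerivAt (by simp)
  rw [pdx_eq_fderiv (differentiableAt_pdt hw), pdt_eq_fderiv (differentiableAt_pdx hw),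
    (pdt_eventuallyEq_fderiv hw).fderiv_eq, (pdx_eventuallyEq_fderiv hw).fderiv_eq,
    fderiv_clm_apply hd (differentiableAt_const _),
    fderiv_clm_apply hd (differentiableAt_const _)]
  simpa using hsymm.eq (1, 0) (0, 1)

end TwiceDifferentiable

/-- If `(u, m)` is a classical solution of the 1D MFG system with coupling `f` on an open
set `Ω`, then `u` satisfies the quasilinear elliptic equation
`-u_tt + 2 u_x u_xt - (u_x² + m f'(m)) u_xx = 0` on `Ω`. -/
theorem stmt0
    (Ω : Set (ℝ × ℝ)) (hΩ : IsOpen Ω)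
    (f : ℝ → ℝ) (hf : ContDiffOn ℝ 1 f (Set.Ioi 0))
    (u m : ℝ → ℝ → ℝ)
    (hu : ContDiffOn ℝ (⊤ : ℕ∞) (fun p : ℝ × ℝ => u p.1 p.2) Ω)
    (hm : ContDiffOn ℝ (⊤ : ℕ∞) (fun p : ℝ × ℝ => m p.1 p.2) Ω)
    (hmpos : ∀ x t : ℝ, (x, t) ∈ Ω → 0 < m x t)
    (hHJ : ∀ x t : ℝ, (x, t) ∈ Ω →
      -pdt u x t + (1/2) * (pdx u x t)^2 = f (m x t))
    (hCE : ∀ x t : ℝ, (x, t) ∈ Ω →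
      pdt m x t - pdx (fun y s => m y s * pdx u y s) x t = 0) :
    ∀ x t : ℝ, (x, t) ∈ Ω →
      -pdt (pdt u) x t + 2 * pdx u x t * pdt (pdx u) x t
        - ((pdx u x t)^2 + m x t * deriv f (m x t)) * pdx (pdx u) x t = 0 := by
  intro x t hxt
  have hnhds : Ω ∈ nhds (x, t) := hΩ.mem_nhds hxt
  have hu2 : ContDiffAt ℝ 2 (fun p : ℝ × ℝ => u p.1 p.2) (x, t) :=
    (hu.contDiffAt hnhds).of_le (WithTop.coe_le_coe.2 le_top)
  have hmd : DifferentiableAt ℝ (fun p : ℝ × ℝ => m p.1 p.2) (x, t) :=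
    (hm.contDiffAt hnhds).differentiableAt (by simp)
  have hfd : HasDerivAt f (deriv f (m x t)) (m x t) :=
    ((hf.contDiffAt (Ioi_mem_nhds (hmpos x t hxt))).differentiableAt (by simp)).hasDerivAt
  have hux := differentiableAt_pdx hu2
  have hut := differentiableAt_pdt hu2
  have hx : ∀ᶠ y in nhds x, (y, t) ∈ Ω :=
    (show ContinuousAt (fun y : ℝ => (y, t)) x by fun_prop).eventually hnhds
  have ht : ∀ᶠ s in nhds t, (x, s) ∈ Ω :=
    (show ContinuousAt (fun s : ℝ => (x, s)) t by fun_prop).eventually hnhds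
  have hHJx := ((hasDerivAt_pdx hut).fun_neg.fun_add
      (((hasDerivAt_pdx hux).fun_pow 2).const_mul (1/2))).unique
    ((hfd.comp x (hasDerivAt_pdx hmd)).congr_of_eventuallyEq (hx.mono fun y hy => hHJ y t hy))
  have hHJt := ((hasDerivAt_pdt hut).fun_neg.fun_add
      (((hasDerivAt_pdt hux).fun_pow 2).const_mul (1/2))).unique
    ((hfd.comp t (hasDerivAt_pdt hmd)).congr_of_eventuallyEq (ht.mono fun s hs => hHJ x s hs))
  have hflux : pdx (fun y s => m y s * pdx u y s) x t =
      pdx m x t * pdx u x t + m x t * pdx (pdx u) x t :=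
    ((hasDerivAt_pdx hmd).fun_mul (hasDerivAt_pdx hux)).deriv
  have hCE' := hCE x t hxt
  rw [hflux] at hCE'
  rw [pdx_pdt_eq_pdt_pdx hu2] at hHJx
  norm_num at hHJx hHJt
  linear_combination hHJt - pdx u x t * hHJx + deriv f (m x t) * hCE'
end

section
/- Let Ω ⊆ ℝ² be open, let f : (0,∞) → ℝ be C², and let (u,m) be a classical solution of the 1D MFG system with coupling f on Ω. Then at every point of Ω the displacement convexity identity m·f'(m)·u_{xx}² + (∂_x(f∘m))² = ∂_x((∂_t(f∘m))·u_x) − ∂_t((∂_x(f∘m))·u_x) holds. -/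
section PartialDerivatives

variable {Ω : Set (ℝ × ℝ)} {g : ℝ → ℝ → ℝ} {x t : ℝ} {n : WithTop ℕ∞}

theorem hasDerivAt_pdx_of_differentiableAt
    (hg : DifferentiableAt ℝ (fun p : ℝ × ℝ => g p.1 p.2) (x, t)) :
    HasDerivAt (fun y => g y t) (fderiv ℝ (fun p : ℝ × ℝ => g p.1 p.2) (x, t) (1, 0)) x :=
  hg.hasFDerivAt.comp_hasDerivAt (f := fun y => (y, t)) x
    ((hasDerivAt_id x).prodMk (hasDerivAt_const x t))

theorem hasDerivAt_pdt_of_differentiableAt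
    (hg : DifferentiableAt ℝ (fun p : ℝ × ℝ => g p.1 p.2) (x, t)) :
    HasDerivAt (fun s => g x s) (fderiv ℝ (fun p : ℝ × ℝ => g p.1 p.2) (x, t) (0, 1)) t :=
  hg.hasFDerivAt.comp_hasDerivAt (f := fun s => (x, s)) t
    ((hasDerivAt_const t x).prodMk (hasDerivAt_id t))

theorem pdx_congr_of_isOpen (hΩ : IsOpen Ω) {a b : ℝ → ℝ → ℝ}
    (h : ∀ x t, (x, t) ∈ Ω → a x t = b x t) (hx : (x, t) ∈ Ω) : pdx a x t = pdx b x t := by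
  apply Filter.EventuallyEq.deriv_eq
  have hc : ContinuousAt (fun y : ℝ => (y, t)) x := by fun_prop
  filter_upwards [hc (hΩ.mem_nhds hx)] with y hy using h y t hy

theorem pdt_congr_of_isOpen (hΩ : IsOpen Ω) {a b : ℝ → ℝ → ℝ}
    (h : ∀ x t, (x, t) ∈ Ω → a x t = b x t) (hx : (x, t) ∈ Ω) : pdt a x t = pdt b x t := by
  apply Filter.EventuallyEq.deriv_eq
  have hc : ContinuousAt (fun s : ℝ => (x, s)) t := by fun_prop
  filter_upwards [hc (hΩ.mem_nhds hx)] with s hs using h x s hs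

theorem differentiableAt_of_contDiffOn_isOpen (hΩ : IsOpen Ω)
    (hg : ContDiffOn ℝ n (fun p : ℝ × ℝ => g p.1 p.2) Ω) (hn : n ≠ 0) (hx : (x, t) ∈ Ω) :
    DifferentiableAt ℝ (fun p : ℝ × ℝ => g p.1 p.2) (x, t) :=
  (hg.contDiffAt (hΩ.mem_nhds hx)).differentiableAt hn

theorem hasDerivAt_pdx_s1 (hΩ : IsOpen Ω)
    (hg : ContDiffOn ℝ n (fun p : ℝ × ℝ => g p.1 p.2) Ω) (hn : n ≠ 0) (hx : (x, t) ∈ Ω) :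
    HasDerivAt (fun y => g y t) (pdx g x t) x :=
  (hasDerivAt_pdx_of_differentiableAt
    (differentiableAt_of_contDiffOn_isOpen hΩ hg hn hx)).differentiableAt.hasDerivAt

theorem hasDerivAt_pdt_s1 (hΩ : IsOpen Ω)
    (hg : ContDiffOn ℝ n (fun p : ℝ × ℝ => g p.1 p.2) Ω) (hn : n ≠ 0) (hx : (x, t) ∈ Ω) :
    HasDerivAt (fun s => g x s) (pdt g x t) t :=
  (hasDerivAt_pdt_of_differentiableAt
    (differentiableAt_of_contDiffOn_isOpen hΩ hg hn hx)).differentiableAt.hasDerivAt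

theorem pdx_eq_fderiv_s1 (hΩ : IsOpen Ω)
    (hg : ContDiffOn ℝ n (fun p : ℝ × ℝ => g p.1 p.2) Ω) (hn : n ≠ 0) (hx : (x, t) ∈ Ω) :
    pdx g x t = fderiv ℝ (fun p : ℝ × ℝ => g p.1 p.2) (x, t) (1, 0) :=
  (hasDerivAt_pdx_of_differentiableAt (differentiableAt_of_contDiffOn_isOpen hΩ hg hn hx)).deriv

theorem pdt_eq_fderiv_s1 (hΩ : IsOpen Ω)
    (hg : ContDiffOn ℝ n (fun p : ℝ × ℝ => g p.1 p.2) Ω) (hn : n ≠ 0) (hx : (x, t) ∈ Ω) :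
    pdt g x t = fderiv ℝ (fun p : ℝ × ℝ => g p.1 p.2) (x, t) (0, 1) :=
  (hasDerivAt_pdt_of_differentiableAt (differentiableAt_of_contDiffOn_isOpen hΩ hg hn hx)).deriv

theorem contDiffOn_pdx (hΩ : IsOpen Ω)
    (hg : ContDiffOn ℝ 2 (fun p : ℝ × ℝ => g p.1 p.2) Ω) :
    ContDiffOn ℝ 1 (fun p : ℝ × ℝ => pdx g p.1 p.2) Ω :=
  ((hg.fderiv_of_isOpen hΩ (m := 1) (by norm_num)).clm_apply contDiffOn_const).congr
    fun _ hp => pdx_eq_fderiv_s1 hΩ hg two_ne_zero hp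

theorem contDiffOn_pdt (hΩ : IsOpen Ω)
    (hg : ContDiffOn ℝ 2 (fun p : ℝ × ℝ => g p.1 p.2) Ω) :
    ContDiffOn ℝ 1 (fun p : ℝ × ℝ => pdt g p.1 p.2) Ω :=
  ((hg.fderiv_of_isOpen hΩ (m := 1) (by norm_num)).clm_apply contDiffOn_const).congr
    fun _ hp => pdt_eq_fderiv_s1 hΩ hg two_ne_zero hp

theorem pdx_pdt_comm (hΩ : IsOpen Ω)
    (hg : ContDiffOn ℝ 2 (fun p : ℝ × ℝ => g p.1 p.2) Ω) (hx : (x, t) ∈ Ω) :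
    pdx (pdt g) x t = pdt (pdx g) x t := by
  have hd : DifferentiableAt ℝ (fderiv ℝ (fun p : ℝ × ℝ => g p.1 p.2)) (x, t) :=
    ((hg.fderiv_of_isOpen hΩ (m := 1) (by norm_num)).contDiffAt
      (hΩ.mem_nhds hx)).differentiableAt one_ne_zero
  have hsymm : IsSymmSndFDerivAt ℝ (fun p : ℝ × ℝ => g p.1 p.2) (x, t) :=
    (hg.contDiffAt (hΩ.mem_nhds hx)).isSymmSndFDerivAt (by simp)
  have happly (v : ℝ × ℝ) : HasFDerivAt
      (fun p : ℝ × ℝ => fderiv ℝ (fun p : ℝ × ℝ => g p.1 p.2) (p.1, p.2) v)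
      ((fderiv ℝ (fderiv ℝ (fun p : ℝ × ℝ => g p.1 p.2)) (x, t)).flip v) (x, t) := by
    simpa using hd.hasFDerivAt.clm_apply (hasFDerivAt_const v (x, t))
  rw [pdx_congr_of_isOpen hΩ (fun _ _ h => pdt_eq_fderiv_s1 hΩ hg two_ne_zero h) hx,
    pdt_congr_of_isOpen hΩ (fun _ _ h => pdx_eq_fderiv_s1 hΩ hg two_ne_zero h) hx]
  unfold pdx pdt
  rw [(hasDerivAt_pdx_of_differentiableAt
      (g := fun x t => fderiv ℝ (fun p : ℝ × ℝ => g p.1 p.2) (x, t) (0, 1))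
      (happly (0, 1)).differentiableAt).deriv,
    (hasDerivAt_pdt_of_differentiableAt
      (g := fun x t => fderiv ℝ (fun p : ℝ × ℝ => g p.1 p.2) (x, t) (1, 0))
      (happly (1, 0)).differentiableAt).deriv,
    (happly (0, 1)).fderiv, (happly (1, 0)).fderiv]
  exact hsymm (1, 0) (0, 1)

end PartialDerivatives

/-- Displacement convexity identity: for a classical solution `(u, m)` of the 1D MFG system
with C² coupling `f` on an open set `Ω`, one has
`m f'(m) u_xx² + (∂ₓ(f∘m))² = ∂ₓ((∂ₜ(f∘m)) u_x) - ∂ₜ((∂ₓ(f∘m)) u_x)` on `Ω`. -/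
theorem stmt1
    (Ω : Set (ℝ × ℝ)) (hΩ : IsOpen Ω)
    (f : ℝ → ℝ) (hf : ContDiffOn ℝ 2 f (Set.Ioi 0))
    (u m : ℝ → ℝ → ℝ)
    (hu : ContDiffOn ℝ (⊤ : ℕ∞) (fun p : ℝ × ℝ => u p.1 p.2) Ω)
    (hm : ContDiffOn ℝ (⊤ : ℕ∞) (fun p : ℝ × ℝ => m p.1 p.2) Ω)
    (hmpos : ∀ x t : ℝ, (x, t) ∈ Ω → 0 < m x t)
    (hHJ : ∀ x t : ℝ, (x, t) ∈ Ω →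
      -pdt u x t + (1/2) * (pdx u x t)^2 = f (m x t))
    (hCE : ∀ x t : ℝ, (x, t) ∈ Ω →
      pdt m x t - pdx (fun y s => m y s * pdx u y s) x t = 0) :
    ∀ x t : ℝ, (x, t) ∈ Ω →
      m x t * deriv f (m x t) * (pdx (pdx u) x t)^2
        + (pdx (fun y s => f (m y s)) x t)^2
      = pdx (fun y s => pdt (fun z r => f (m z r)) y s * pdx u y s) x t
        - pdt (fun y s => pdx (fun z r => f (m z r)) y s * pdx u y s) x t := by
  intro x t hx
  have hu2 : ContDiffOn ℝ 2 (fun p : ℝ × ℝ => u p.1 p.2) Ω := contDiffOn_infty.1 hu 2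
  have hm2 : ContDiffOn ℝ 2 (fun p : ℝ × ℝ => m p.1 p.2) Ω := contDiffOn_infty.1 hm 2
  set F : ℝ → ℝ → ℝ := fun z r => f (m z r) with hF
  have hF2 : ContDiffOn ℝ 2 (fun p : ℝ × ℝ => F p.1 p.2) Ω :=
    hf.comp hm2 fun p hp => hmpos p.1 p.2 hp
  have hf' : HasDerivAt f (deriv f (m x t)) (m x t) :=
    ((hf.contDiffAt (Ioi_mem_nhds (hmpos x t hx))).differentiableAt two_ne_zero).hasDerivAt
  have hux := contDiffOn_pdx hΩ hu2
  have huxx := hasDerivAt_pdx_s1 hΩ hux one_ne_zero hx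
  have huxt := hasDerivAt_pdt_s1 hΩ hux one_ne_zero hx
  have hmx := hasDerivAt_pdx_s1 hΩ hm2 two_ne_zero hx
  have hFx : pdx F x t = deriv f (m x t) * pdx m x t := (hf'.comp x hmx).deriv
  have hFt : pdt F x t = deriv f (m x t) * pdt m x t :=
    (hf'.comp t (hasDerivAt_pdt_s1 hΩ hm2 two_ne_zero hx)).deriv
  have hflux_x : pdx (fun y s => pdt F y s * pdx u y s) x t =
      pdx (pdt F) x t * pdx u x t + pdt F x t * pdx (pdx u) x t :=
    ((hasDerivAt_pdx_s1 hΩ (contDiffOn_pdt hΩ hF2) one_ne_zero hx).mul huxx).deriv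
  have hflux_t : pdt (fun y s => pdx F y s * pdx u y s) x t =
      pdt (pdx F) x t * pdx u x t + pdx F x t * pdt (pdx u) x t :=
    ((hasDerivAt_pdt_s1 hΩ (contDiffOn_pdx hΩ hF2) one_ne_zero hx).mul huxt).deriv
  have hmass : pdx (fun y s => m y s * pdx u y s) x t =
      pdx m x t * pdx u x t + m x t * pdx (pdx u) x t := (hmx.mul huxx).deriv
  have hHJx : pdx F x t = -pdx (pdt u) x t + pdx u x t * pdx (pdx u) x t := by
    rw [← pdx_congr_of_isOpen hΩ hHJ hx]
    refine ((hasDerivAt_pdx_s1 hΩ (contDiffOn_pdt hΩ hu2) one_ne_zero hx).neg.add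
      ((huxx.pow 2).const_mul (1 / 2))).deriv.trans ?_
    norm_num
    ring
  have hmt := hCE x t hx
  rw [hmass] at hmt
  rw [pdx_pdt_comm hΩ hu2 hx] at hHJx
  rw [hflux_x, hflux_t, pdx_pdt_comm hΩ hF2 hx, hFt]
  linear_combination pdx F x t * hHJx + pdx u x t * pdx (pdx u) x t * hFx
    - deriv f (m x t) * pdx (pdx u) x t * hmt
end

section
/- Let R ≥ 1, T > 0, let f : (0,∞) → ℝ be C¹ with f' > 0 on (0,∞), and let (u,m) be a classical R-periodic solution of the 1D MFG system with coupling f on ℝ × [0,T]. Then sup_{(x,t) ∈ ℝ×[0,T]} m(x,t) ≤ max( sup_{x∈ℝ} m(x,0), sup_{x∈ℝ} m(x,T) ) and sup_{(x,t) ∈ ℝ×[0,T]} m(x,t)^{-1} ≤ max( sup_{x∈ℝ} m(x,0)^{-1}, sup_{x∈ℝ} m(x,T)^{-1} ). -/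
open Set

open Filter Topology
open scoped ContDiff

theorem second_deriv_nonpos_of_isLocalMax {h h' : ℝ → ℝ} {x c : ℝ} (hmax : IsLocalMax h x)
    (hh : ∀ᶠ s in 𝓝 x, HasDerivAt h (h' s) s) (hh' : HasDerivAt h' c x) : c ≤ 0 := by
  by_contra! hc
  have hd : deriv h =ᶠ[𝓝 x] h' := hh.mono fun s hs => hs.deriv
  have hdd : deriv (deriv h) x = c := by rw [hd.deriv_eq, hh'.deriv]
  have hmin := isLocalMin_of_deriv_deriv_pos (f := h) (x₀ := x) (by rwa [hdd])
    hmax.deriv_eq_zero hh.self_of_nhds.continuousAt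
  have hconst : h =ᶠ[𝓝 x] fun _ => h x := by
    filter_upwards [hmax, hmin] with s h1 h2 using le_antisymm h1 h2
  have h0 : deriv h =ᶠ[𝓝 x] fun _ => 0 := by
    have := hconst.deriv
    simpa using this
  rw [h0.deriv_eq] at hdd
  simp at hdd
  exact hc.ne hdd

/-- The directional derivative of `W` in the constant direction `d`. -/
noncomputable def dirDeriv (d : ℝ × ℝ) (W : ℝ × ℝ → ℝ) (p : ℝ × ℝ) : ℝ := fderiv ℝ W p d

theorem ContDiffAt.dirDeriv {W : ℝ × ℝ → ℝ} {p : ℝ × ℝ} (hW : ContDiffAt ℝ ∞ W p) (d : ℝ × ℝ) :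
    ContDiffAt ℝ ∞ (dirDeriv d W) p :=
  (hW.fderiv_right (m := ∞) (by simp)).clm_apply contDiffAt_const

theorem hasDerivAt_comp_line {W : ℝ × ℝ → ℝ} {p d : ℝ × ℝ} {s : ℝ}
    (hW : ContDiffAt ℝ ∞ W (p + s • d)) :
    HasDerivAt (fun r : ℝ => W (p + r • d)) (dirDeriv d W (p + s • d)) s := by
  have h1 : HasDerivAt (fun r : ℝ => p + r • d) d s := by
    simpa using ((hasDerivAt_id s).smul_const d).const_add p
  exact (hW.differentiableAt (by simp)).hasFDerivAt.comp_hasDerivAt s h1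

theorem dirDeriv_comm {W : ℝ × ℝ → ℝ} {p : ℝ × ℝ} (hW : ContDiffAt ℝ ∞ W p) (d e : ℝ × ℝ) :
    dirDeriv d (dirDeriv e W) p = dirDeriv e (dirDeriv d W) p := by
  have hs : IsSymmSndFDerivAt ℝ W p := hW.isSymmSndFDerivAt
    (by simpa using WithTop.coe_le_coe.2 (le_top : (2 : ℕ∞) ≤ ⊤))
  have hd : DifferentiableAt ℝ (fderiv ℝ W) p :=
    (hW.fderiv_right (m := ∞) (by simp)).differentiableAt (by simp)
  have key : ∀ a b : ℝ × ℝ, dirDeriv a (dirDeriv b W) p = fderiv ℝ (fderiv ℝ W) p a b := by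
    intro a b
    change fderiv ℝ (fun q => fderiv ℝ W q b) p a = _
    rw [fderiv_clm_apply hd (differentiableAt_const b)]
    simp
  rw [key, key, hs]

theorem dirDeriv_mul {V W : ℝ × ℝ → ℝ} {p : ℝ × ℝ} (hV : ContDiffAt ℝ ∞ V p)
    (hW : ContDiffAt ℝ ∞ W p) (d : ℝ × ℝ) :
    dirDeriv d (fun q => V q * W q) p = dirDeriv d V p * W p + V p * dirDeriv d W p := by
  simp only [dirDeriv]
  rw [fderiv_fun_mul (hV.differentiableAt (by simp)) (hW.differentiableAt (by simp))]
  simp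
  ring

theorem dirDeriv_add {V W : ℝ × ℝ → ℝ} {p : ℝ × ℝ} (hV : ContDiffAt ℝ ∞ V p)
    (hW : ContDiffAt ℝ ∞ W p) (d : ℝ × ℝ) :
    dirDeriv d (fun q => V q + W q) p = dirDeriv d V p + dirDeriv d W p := by
  simp only [dirDeriv]
  rw [fderiv_fun_add (hV.differentiableAt (by simp)) (hW.differentiableAt (by simp))]
  simp

theorem dirDeriv_neg (W : ℝ × ℝ → ℝ) (p d : ℝ × ℝ) :
    dirDeriv d (fun q => -W q) p = -dirDeriv d W p := by
  simp [dirDeriv, fderiv_fun_neg]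

theorem Filter.EventuallyEq.dirDeriv_eq {V W : ℝ × ℝ → ℝ} {p : ℝ × ℝ} (h : V =ᶠ[𝓝 p] W)
    (d : ℝ × ℝ) : dirDeriv d V p = dirDeriv d W p := by
  simp [dirDeriv, h.fderiv_eq]

theorem dirDeriv_neg_one_eq (W : ℝ × ℝ → ℝ) (p : ℝ × ℝ) (a : ℝ) :
    dirDeriv (-a, 1) W p = dirDeriv (0, 1) W p - a * dirDeriv (1, 0) W p := by
  have : ((-a, 1) : ℝ × ℝ) = (0, 1) - a • (1, 0) := by ext <;> simp
  simp only [dirDeriv, this, map_sub, map_smul, smul_eq_mul]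

/-- For the Galilean direction `d = (-U_x(p), 1)`, the Hamilton–Jacobi and continuity equations give
`D_d² G = (D_d G)² - F_xx` at a point where the logarithm `G` of the density has `G_x = 0`. -/
theorem secondDirDeriv_log_density {U G F : ℝ × ℝ → ℝ} {p : ℝ × ℝ}
    (hU : ∀ᶠ q in 𝓝 p, ContDiffAt ℝ ∞ U q) (hG : ∀ᶠ q in 𝓝 p, ContDiffAt ℝ ∞ G q)
    (hF : ∀ᶠ q in 𝓝 p,
      F q = -dirDeriv (0, 1) U q + (1 / 2) * (dirDeriv (1, 0) U q * dirDeriv (1, 0) U q))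
    (hCE : ∀ᶠ q in 𝓝 p, dirDeriv (0, 1) G q =
      dirDeriv (1, 0) U q * dirDeriv (1, 0) G q + dirDeriv (1, 0) (dirDeriv (1, 0) U) q)
    (hcrit : dirDeriv (1, 0) G p = 0) :
    dirDeriv (-dirDeriv (1, 0) U p, 1) (dirDeriv (-dirDeriv (1, 0) U p, 1) G) p =
      (dirDeriv (-dirDeriv (1, 0) U p, 1) G p) ^ 2 - dirDeriv (1, 0) (dirDeriv (1, 0) F) p := by
  set a := dirDeriv (1, 0) U p with ha
  have hUp := hU.self_of_nhds
  have hGp := hG.self_of_nhds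
  have hFx : dirDeriv (1, 0) F =ᶠ[𝓝 p] fun q => -dirDeriv (1, 0) (dirDeriv (0, 1) U) q +
      dirDeriv (1, 0) U q * dirDeriv (1, 0) (dirDeriv (1, 0) U) q := by
    filter_upwards [hF.eventually_nhds, hU] with q hq hUq
    rw [Filter.EventuallyEq.dirDeriv_eq hq]
    rw [dirDeriv_add (hUq.dirDeriv _).neg
      (contDiffAt_const.mul ((hUq.dirDeriv _).mul (hUq.dirDeriv _))), dirDeriv_neg,
      dirDeriv_mul contDiffAt_const ((hUq.dirDeriv _).mul (hUq.dirDeriv _)),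
      dirDeriv_mul (hUq.dirDeriv _) (hUq.dirDeriv _)]
    simp only [dirDeriv, fderiv_const_apply]
    simp
    ring
  have hFxx : dirDeriv (1, 0) (dirDeriv (1, 0) F) p =
      -dirDeriv (1, 0) (dirDeriv (1, 0) (dirDeriv (0, 1) U)) p +
      ((dirDeriv (1, 0) (dirDeriv (1, 0) U) p) ^ 2 +
        a * dirDeriv (1, 0) (dirDeriv (1, 0) (dirDeriv (1, 0) U)) p) := by
    rw [hFx.dirDeriv_eq, dirDeriv_add ((hUp.dirDeriv _).dirDeriv _).neg
      ((hUp.dirDeriv _).mul ((hUp.dirDeriv _).dirDeriv _)), dirDeriv_neg,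
      dirDeriv_mul (hUp.dirDeriv _) ((hUp.dirDeriv _).dirDeriv _), sq]
  have hsymm : dirDeriv (0, 1) (dirDeriv (1, 0) (dirDeriv (1, 0) U)) p =
      dirDeriv (1, 0) (dirDeriv (1, 0) (dirDeriv (0, 1) U)) p := by
    rw [dirDeriv_comm (hUp.dirDeriv _)]
    refine Filter.EventuallyEq.dirDeriv_eq ?_ _
    filter_upwards [hU] with q hq using dirDeriv_comm hq _ _
  have hDG : dirDeriv (-a, 1) G =ᶠ[𝓝 p] fun q => (dirDeriv (1, 0) U q + -a) *
      dirDeriv (1, 0) G q + dirDeriv (1, 0) (dirDeriv (1, 0) U) q := by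
    filter_upwards [hCE] with q hq
    rw [dirDeriv_neg_one_eq, hq]
    ring
  rw [hDG.dirDeriv_eq, hDG.self_of_nhds, dirDeriv_add
    (((hUp.dirDeriv _).add contDiffAt_const).mul (hGp.dirDeriv _))
    ((hUp.dirDeriv _).dirDeriv _), dirDeriv_mul ((hUp.dirDeriv _).add contDiffAt_const)
    (hGp.dirDeriv _), hcrit, ← ha, dirDeriv_neg_one_eq (dirDeriv (1, 0) (dirDeriv (1, 0) U)),
    hsymm, hFxx]
  ring

/-- A function periodic in space on the strip, none of whose perturbations `g + ε t²` has an interior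
local maximum, is bounded by its values at the extremal times. -/
theorem le_of_forall_not_isLocalMax_add_sq {R T ε₀ : ℝ} (hR : 0 < R) (hT : 0 < T) (hε₀ : 0 < ε₀)
    {g : ℝ × ℝ → ℝ} (hg : ContinuousOn g {p | p.2 ∈ Icc 0 T})
    (hper : ∀ x t, t ∈ Icc 0 T → g (x + R, t) = g (x, t))
    (hloc : ∀ ε ∈ Ioo 0 ε₀, ∀ p : ℝ × ℝ, p.2 ∈ Ioo 0 T →
      ¬ IsLocalMax (fun q => g q + ε * q.2 ^ 2) p)
    {c : ℝ} (h0 : ∀ x, g (x, 0) ≤ c) (h1 : ∀ x, g (x, T) ≤ c) {x t : ℝ} (ht : t ∈ Icc 0 T) :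
    g (x, t) ≤ c := by
  have hbound : ∀ ε ∈ Ioo 0 ε₀, g (x, t) ≤ c + ε * T ^ 2 := by
    intro ε hε
    have hcomp : IsCompact (Icc (0 : ℝ) R ×ˢ Icc (0 : ℝ) T) := isCompact_Icc.prod isCompact_Icc
    have hne : (Icc (0 : ℝ) R ×ˢ Icc (0 : ℝ) T).Nonempty :=
      ⟨(0, 0), ⟨⟨le_rfl, hR.le⟩, ⟨le_rfl, hT.le⟩⟩⟩
    obtain ⟨p, hp, hpmax⟩ := hcomp.exists_isMaxOn (f := fun q => g q + ε * q.2 ^ 2) hne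
      ((hg.mono fun q hq => hq.2).add (by fun_prop))
    have hglob : ∀ y s, s ∈ Icc 0 T → g (y, s) + ε * s ^ 2 ≤ g p + ε * p.2 ^ 2 := by
      intro y s hs
      have hP : Function.Periodic (fun z => g (z, s)) R := fun z => hper z s hs
      obtain ⟨z, hz, hzy⟩ := hP.exists_mem_Ico₀ hR y
      have hle : g (z, s) + ε * s ^ 2 ≤ g p + ε * p.2 ^ 2 :=
        hpmax (show ((z, s) : ℝ × ℝ) ∈ Icc (0 : ℝ) R ×ˢ Icc (0 : ℝ) T from
        ⟨Ico_subset_Icc_self hz, hs⟩)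
      exact hzy ▸ hle
    have hp2 : p.2 = 0 ∨ p.2 = T := by
      by_contra! hcon
      have hpi : p.2 ∈ Ioo 0 T :=
        ⟨lt_of_le_of_ne hp.2.1 hcon.1.symm, lt_of_le_of_ne hp.2.2 hcon.2⟩
      refine hloc ε hε p hpi ?_
      filter_upwards [continuous_snd.continuousAt.preimage_mem_nhds (Ioo_mem_nhds hpi.1 hpi.2)]
        with q hq using hglob q.1 q.2 (Ioo_subset_Icc_self hq)
    have hpc : g p ≤ c := by
      rcases hp2 with h | h
      · rw [← Prod.mk.eta (p := p), h]; exact h0 _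
      · rw [← Prod.mk.eta (p := p), h]; exact h1 _
    have hsq : p.2 ^ 2 ≤ T ^ 2 := pow_le_pow_left₀ hp.2.1 hp.2.2 2
    nlinarith [hglob x t ht, mul_le_mul_of_nonneg_left hsq hε.1.le,
      mul_nonneg hε.1.le (sq_nonneg t)]
  have hlim : Tendsto (fun ε : ℝ => c + ε * T ^ 2) (𝓝[>] 0) (𝓝 c) := by
    have : Continuous fun ε : ℝ => c + ε * T ^ 2 := by fun_prop
    simpa using (this.tendsto 0).mono_left nhdsWithin_le_nhds
  refine ge_of_tendsto hlim ?_
  filter_upwards [Ioo_mem_nhdsGT hε₀] with ε hε using hbound ε hε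

theorem HasDerivAt.const_mul_add_sq {L : ℝ → ℝ} {L' s : ℝ} (hL : HasDerivAt L L' s) (σ ε τ : ℝ) :
    HasDerivAt (fun r => σ * L r + ε * (τ + r) ^ 2) (σ * L' + 2 * ε * (τ + s)) s := by
  have h := (hL.const_mul σ).add ((((hasDerivAt_id s).const_add τ).pow 2).const_mul ε)
  refine h.congr_deriv ?_
  simp
  ring

theorem eventually_line {P : ℝ × ℝ → Prop} {p : ℝ × ℝ} (h : ∀ᶠ q in 𝓝 p, P q) (d : ℝ × ℝ) :
    ∀ᶠ s : ℝ in 𝓝 0, P (p + s • d) := by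
  have hc : Tendsto (fun s : ℝ => p + s • d) (𝓝 0) (𝓝 p) := by
    have : Continuous fun s : ℝ => p + s • d := by fun_prop
    simpa using this.tendsto 0
  exact hc.eventually h

/-- No small perturbation `± G + ε t²` of the log-density has an interior local maximum. -/
theorem not_isLocalMax_log_density_add_sq {U G F : ℝ × ℝ → ℝ} {p : ℝ × ℝ} {σ ε : ℝ}
    (hσ : σ ^ 2 = 1) (hε : 0 < ε) (hεp : 2 * ε * p.2 ^ 2 < 1)
    (hU : ∀ᶠ q in 𝓝 p, ContDiffAt ℝ ∞ U q) (hG : ∀ᶠ q in 𝓝 p, ContDiffAt ℝ ∞ G q)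
    (hF : ∀ᶠ q in 𝓝 p,
      F q = -dirDeriv (0, 1) U q + (1 / 2) * (dirDeriv (1, 0) U q * dirDeriv (1, 0) U q))
    (hCE : ∀ᶠ q in 𝓝 p, dirDeriv (0, 1) G q =
      dirDeriv (1, 0) U q * dirDeriv (1, 0) G q + dirDeriv (1, 0) (dirDeriv (1, 0) U) q)
    (hmono : ∀ᶠ q in 𝓝 p, σ * G q ≤ σ * G p → σ * F q ≤ σ * F p) :
    ¬ IsLocalMax (fun q => σ * G q + ε * q.2 ^ 2) p := by
  intro hmax
  have hσ0 : σ ≠ 0 := by rintro rfl; norm_num at hσ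
  have hline : ∀ d, IsLocalMax (fun s : ℝ => σ * G (p + s • d) + ε * (p + s • d).2 ^ 2) 0 := by
    intro d
    have := eventually_line hmax d
    simpa [IsLocalMax, IsMaxFilter] using this
  have hx := hline (1, 0)
  simp only [Prod.snd_add, Prod.smul_snd, smul_zero, add_zero] at hx
  have hcrit : dirDeriv (1, 0) G p = 0 := by
    have h := hasDerivAt_comp_line (W := G) (p := p) (d := (1, 0)) (s := 0)
      (by simpa using hG.self_of_nhds)
    have := hx.hasDerivAt_eq_zero ((h.const_mul σ).add_const (ε * p.2 ^ 2))
    simpa [hσ0] using this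
  have hFsmooth : ∀ᶠ q in 𝓝 p, ContDiffAt ℝ ∞ F q := by
    filter_upwards [hF.eventually_nhds, hU] with q hq hUq
    exact ((hUq.dirDeriv _).neg.add
      (contDiffAt_const.mul ((hUq.dirDeriv _).mul (hUq.dirDeriv _)))).congr_of_eventuallyEq hq
  have hFxx : σ * dirDeriv (1, 0) (dirDeriv (1, 0) F) p ≤ 0 := by
    have hFmax : IsLocalMax (fun s : ℝ => σ * F (p + s • ((1, 0) : ℝ × ℝ))) 0 := by
      filter_upwards [hx, eventually_line hmono (1, 0)] with s h1 h2
      simpa using h2 (by simpa using h1)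
    refine second_deriv_nonpos_of_isLocalMax hFmax
      (h' := fun s : ℝ => σ * dirDeriv (1, 0) F (p + s • ((1, 0) : ℝ × ℝ))) ?_ ?_
    · filter_upwards [eventually_line hFsmooth (1, 0)] with s hs
      exact (hasDerivAt_comp_line hs).const_mul σ
    · simpa using (hasDerivAt_comp_line (W := dirDeriv (1, 0) F) (p := p) (d := (1, 0)) (s := 0)
        (by simpa using hFsmooth.self_of_nhds.dirDeriv _)).const_mul σ
  have hsecond := secondDirDeriv_log_density hU hG hF hCE hcrit
  set d : ℝ × ℝ := (-dirDeriv (1, 0) U p, 1) with hd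
  have hmaxd := hline d
  simp only [hd, Prod.snd_add, Prod.smul_snd, smul_eq_mul, mul_one] at hmaxd
  rw [← hd] at hmaxd
  have h1 : ∀ᶠ s : ℝ in 𝓝 0, HasDerivAt (fun s : ℝ => σ * G (p + s • d) + ε * (p.2 + s) ^ 2)
      (σ * dirDeriv d G (p + s • d) + 2 * ε * (p.2 + s)) s := by
    filter_upwards [eventually_line hG d] with s hs
    exact (hasDerivAt_comp_line hs).const_mul_add_sq σ ε p.2
  have h2 : HasDerivAt (fun s : ℝ => σ * dirDeriv d G (p + s • d) + 2 * ε * (p.2 + s))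
      (σ * dirDeriv d (dirDeriv d G) p + 2 * ε) 0 := by
    have h := hasDerivAt_comp_line (W := dirDeriv d G) (p := p) (d := d) (s := 0)
      (by simpa using hG.self_of_nhds.dirDeriv d)
    simpa using (h.const_mul σ).fun_add (((hasDerivAt_id (0 : ℝ)).const_add p.2).const_mul (2 * ε))
  have hle := second_deriv_nonpos_of_isLocalMax hmaxd h1 h2
  have hzero := hmaxd.hasDerivAt_eq_zero h1.self_of_nhds
  simp only [zero_smul, add_zero] at hzero
  rw [hsecond] at hle
  have hsq : (dirDeriv d G p) ^ 2 = (2 * ε * p.2) ^ 2 := by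
    have : σ * dirDeriv d G p = -(2 * ε * p.2) := by linarith
    calc (dirDeriv d G p) ^ 2 = (σ * dirDeriv d G p) ^ 2 := by rw [mul_pow, hσ, one_mul]
      _ = _ := by rw [this]; ring
  have hσ1 : -1 ≤ σ := by nlinarith
  have hkey : 2 * ε * (2 * ε * p.2 ^ 2) < 2 * ε * 1 :=
    mul_lt_mul_of_pos_left hεp (by positivity)
  rw [hsq] at hle
  nlinarith [mul_le_mul_of_nonneg_right hσ1 (sq_nonneg (2 * ε * p.2))]

theorem pdx_eq_dirDeriv {w : ℝ → ℝ → ℝ} {x t : ℝ}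
    (hw : ContDiffAt ℝ ∞ (fun p : ℝ × ℝ => w p.1 p.2) (x, t)) :
    pdx w x t = dirDeriv (1, 0) (fun p => w p.1 p.2) (x, t) := by
  have h := (hw.differentiableAt (by simp)).hasFDerivAt.comp_hasDerivAt x
    ((hasDerivAt_id' x).prodMk (hasDerivAt_const x t))
  exact h.deriv

theorem pdt_eq_dirDeriv {w : ℝ → ℝ → ℝ} {x t : ℝ}
    (hw : ContDiffAt ℝ ∞ (fun p : ℝ × ℝ => w p.1 p.2) (x, t)) :
    pdt w x t = dirDeriv (0, 1) (fun p => w p.1 p.2) (x, t) := by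
  have h := (hw.differentiableAt (by simp)).hasFDerivAt.comp_hasDerivAt t
    ((hasDerivAt_const t x).prodMk (hasDerivAt_id' t))
  exact h.deriv

theorem dirDeriv_log {W : ℝ × ℝ → ℝ} {p : ℝ × ℝ} (hW : ContDiffAt ℝ ∞ W p) (hp : 0 < W p)
    (d : ℝ × ℝ) : dirDeriv d (fun q => Real.log (W q)) p = (W p)⁻¹ * dirDeriv d W p := by
  simp only [dirDeriv]
  rw [((hW.differentiableAt (by simp)).hasFDerivAt.log hp.ne').fderiv]
  simp

theorem bddAbove_range_of_periodic {h : ℝ → ℝ} {R : ℝ} (hR : R ≠ 0) (hc : Continuous h)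
    (hp : Function.Periodic h R) : BddAbove (range h) :=
  (hp.compact_of_continuous hR hc).bddAbove

/-- For a classical `R`-periodic solution `(u, m)` of the 1D MFG system with increasing C¹
coupling `f` on `ℝ × [0,T]`, the density `m` and its reciprocal attain their suprema at the
extremal times: `sup m ≤ max (sup m(·,0)) (sup m(·,T))`, and likewise for `m⁻¹`. -/
theorem stmt4
    (R T : ℝ) (hR : 1 ≤ R) (hT : 0 < T)
    (f : ℝ → ℝ) (hf : ContDiffOn ℝ 1 f (Ioi 0))
    (hf' : ∀ s ∈ Ioi (0:ℝ), 0 < deriv f s)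
    (u m : ℝ → ℝ → ℝ)
    (hu : ContDiffOn ℝ (⊤ : ℕ∞) (fun p : ℝ × ℝ => u p.1 p.2) {p : ℝ × ℝ | p.2 ∈ Icc 0 T})
    (hm : ContDiffOn ℝ (⊤ : ℕ∞) (fun p : ℝ × ℝ => m p.1 p.2) {p : ℝ × ℝ | p.2 ∈ Icc 0 T})
    (huper : ∀ x t : ℝ, t ∈ Icc 0 T → u (x + R) t = u x t)
    (hmper : ∀ x t : ℝ, t ∈ Icc 0 T → m (x + R) t = m x t)
    (hmpos : ∀ x t : ℝ, t ∈ Icc 0 T → 0 < m x t)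
    (hHJ : ∀ x t : ℝ, t ∈ Icc 0 T →
      -pdt u x t + (1/2) * (pdx u x t)^2 = f (m x t))
    (hCE : ∀ x t : ℝ, t ∈ Icc 0 T →
      pdt m x t - pdx (fun y s => m y s * pdx u y s) x t = 0) :
    (∀ x t : ℝ, t ∈ Icc 0 T →
      m x t ≤ max (⨆ y : ℝ, m y 0) (⨆ y : ℝ, m y T)) ∧
    (∀ x t : ℝ, t ∈ Icc 0 T →
      (m x t)⁻¹ ≤ max (⨆ y : ℝ, (m y 0)⁻¹) (⨆ y : ℝ, (m y T)⁻¹)) := by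
  set U : ℝ × ℝ → ℝ := fun p => u p.1 p.2
  set M : ℝ × ℝ → ℝ := fun p => m p.1 p.2 with hMdef
  have hR0 : 0 < R := by linarith
  have hΩ : IsOpen {p : ℝ × ℝ | p.2 ∈ Ioo 0 T} := isOpen_Ioo.preimage continuous_snd
  have hsub : {p : ℝ × ℝ | p.2 ∈ Ioo 0 T} ⊆ {p : ℝ × ℝ | p.2 ∈ Icc 0 T} :=
    fun p hp => Ioo_subset_Icc_self hp
  have hUs : ∀ q : ℝ × ℝ, q.2 ∈ Ioo 0 T → ContDiffAt ℝ ∞ U q := fun q hq =>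
    (hu.mono hsub).contDiffAt (hΩ.mem_nhds hq)
  have hMs : ∀ q : ℝ × ℝ, q.2 ∈ Ioo 0 T → ContDiffAt ℝ ∞ M q := fun q hq =>
    (hm.mono hsub).contDiffAt (hΩ.mem_nhds hq)
  have hMpos : ∀ q : ℝ × ℝ, q.2 ∈ Icc 0 T → 0 < M q := fun q hq => hmpos q.1 q.2 hq
  have hf_mono : StrictMonoOn f (Ioi 0) :=
    strictMonoOn_of_deriv_pos (convex_Ioi 0) hf.continuousOn (by simpa using hf')
  have hHJ' : ∀ q : ℝ × ℝ, q.2 ∈ Ioo 0 T → f (M q) =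
      -dirDeriv (0, 1) U q + (1 / 2) * (dirDeriv (1, 0) U q * dirDeriv (1, 0) U q) := by
    intro q hq
    have h := hHJ q.1 q.2 (Ioo_subset_Icc_self hq)
    rw [pdt_eq_dirDeriv (hUs q hq), pdx_eq_dirDeriv (hUs q hq)] at h
    rw [← sq]
    exact h.symm
  have hCE' : ∀ q : ℝ × ℝ, q.2 ∈ Ioo 0 T → dirDeriv (0, 1) (fun q => Real.log (M q)) q =
      dirDeriv (1, 0) U q * dirDeriv (1, 0) (fun q => Real.log (M q)) q +
        dirDeriv (1, 0) (dirDeriv (1, 0) U) q := by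
    intro q hq
    have hq' := Ioo_subset_Icc_self hq
    have h := hCE q.1 q.2 hq'
    have hflux : pdx (fun y s => m y s * pdx u y s) q.1 q.2 =
        pdx (fun y s => M (y, s) * dirDeriv (1, 0) U (y, s)) q.1 q.2 := by
      have : (fun y => m y q.2 * pdx u y q.2) =
          fun y => M (y, q.2) * dirDeriv (1, 0) U (y, q.2) := by
        funext y
        rw [pdx_eq_dirDeriv (hUs (y, q.2) hq)]
      simp only [pdx] at this ⊢
      rw [this]
    rw [pdt_eq_dirDeriv (hMs q hq), hflux,
      pdx_eq_dirDeriv ((hMs q hq).mul ((hUs q hq).dirDeriv (1, 0)))] at h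
    have h' : dirDeriv (0, 1) M q -
        dirDeriv (1, 0) (fun q => M q * dirDeriv (1, 0) U q) q = 0 := h
    rw [dirDeriv_mul (hMs q hq) ((hUs q hq).dirDeriv _)] at h'
    have hpos := hMpos q hq'
    rw [dirDeriv_log (hMs q hq) hpos, dirDeriv_log (hMs q hq) hpos]
    field_simp
    linarith
  have hcont : ContinuousOn (fun q => Real.log (M q)) {p : ℝ × ℝ | p.2 ∈ Icc 0 T} :=
    hm.continuousOn.log fun q hq => (hMpos q hq).ne'
  have key : ∀ σ : ℝ, (σ = 1 ∨ σ = -1) → ∀ c : ℝ, (∀ y, σ * Real.log (m y 0) ≤ c) →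
      (∀ y, σ * Real.log (m y T) ≤ c) →
      ∀ x t, t ∈ Icc 0 T → σ * Real.log (m x t) ≤ c := by
    intro σ hσ c h0 h1 x t ht
    refine le_of_forall_not_isLocalMax_add_sq (R := R) (T := T) (ε₀ := 1 / (2 * T ^ 2))
      (g := fun q => σ * Real.log (M q)) hR0 hT (by positivity) (continuousOn_const.mul hcont)
      (fun x t ht => by simp only [hMdef, hmper x t ht]) ?_ h0 h1 ht
    intro ε hε p hp
    have hnhds : ∀ᶠ q in 𝓝 p, q.2 ∈ Ioo 0 T := hΩ.mem_nhds hp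
    refine not_isLocalMax_log_density_add_sq (U := U) (G := fun q => Real.log (M q))
      (F := fun q => f (M q)) (by rcases hσ with rfl | rfl <;> norm_num) hε.1 ?_
      (hnhds.mono hUs) (hnhds.mono fun q hq => (hMs q hq).log (hMpos q (hsub hq)).ne')
      (hnhds.mono hHJ') (hnhds.mono hCE') ?_
    · have h2 := hε.2
      rw [lt_div_iff₀ (by positivity)] at h2
      have hsq : p.2 ^ 2 ≤ T ^ 2 := pow_le_pow_left₀ hp.1.le hp.2.le 2
      nlinarith [mul_le_mul_of_nonneg_left hsq hε.1.le]
    · filter_upwards [hnhds] with q hq hle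
      have hqpos := hMpos q (hsub hq)
      have hppos := hMpos p (hsub hp)
      rcases hσ with rfl | rfl
      · simp only [one_mul] at hle ⊢
        exact hf_mono.monotoneOn hqpos hppos ((Real.log_le_log_iff hqpos hppos).1 hle)
      · simp only [neg_mul, one_mul, neg_le_neg_iff] at hle ⊢
        exact hf_mono.monotoneOn hppos hqpos ((Real.log_le_log_iff hppos hqpos).1 hle)
  have h0T : (0 : ℝ) ∈ Icc 0 T := ⟨le_rfl, hT.le⟩
  have hTT : T ∈ Icc 0 T := ⟨hT.le, le_rfl⟩
  have hslice : ∀ t ∈ Icc 0 T, Continuous fun y => m y t := fun t ht =>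
    hm.continuousOn.comp_continuous (f := fun y : ℝ => (y, t)) (by fun_prop) fun _ => ht
  have hbdd : ∀ t ∈ Icc 0 T, BddAbove (range fun y => m y t) := fun t ht =>
    bddAbove_range_of_periodic hR0.ne' (hslice t ht) fun y => hmper y t ht
  have hbdd' : ∀ t ∈ Icc 0 T, BddAbove (range fun y => (m y t)⁻¹) := fun t ht =>
    bddAbove_range_of_periodic hR0.ne' ((hslice t ht).inv₀ fun y => (hmpos y t ht).ne')
      fun y => by simp only [hmper y t ht]
  constructor
  · intro x t ht
    have hpos : 0 < max (⨆ y : ℝ, m y 0) (⨆ y : ℝ, m y T) :=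
      ((hmpos 0 0 h0T).trans_le (le_ciSup (hbdd 0 h0T) 0)).trans_le (le_max_left _ _)
    have := key 1 (Or.inl rfl) (Real.log (max (⨆ y : ℝ, m y 0) (⨆ y : ℝ, m y T)))
      (fun y => by
        rw [one_mul]
        exact Real.log_le_log (hmpos y 0 h0T) ((le_ciSup (hbdd 0 h0T) y).trans (le_max_left _ _)))
      (fun y => by
        rw [one_mul]
        exact Real.log_le_log (hmpos y T hTT) ((le_ciSup (hbdd T hTT) y).trans (le_max_right _ _)))
      x t ht
    rw [one_mul] at this
    exact (Real.log_le_log_iff (hmpos x t ht) hpos).1 this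
  · intro x t ht
    have hpos : 0 < max (⨆ y : ℝ, (m y 0)⁻¹) (⨆ y : ℝ, (m y T)⁻¹) :=
      ((inv_pos.2 (hmpos 0 0 h0T)).trans_le (le_ciSup (hbdd' 0 h0T) 0)).trans_le (le_max_left _ _)
    have := key (-1) (Or.inr rfl)
      (Real.log (max (⨆ y : ℝ, (m y 0)⁻¹) (⨆ y : ℝ, (m y T)⁻¹)))
      (fun y => by
        rw [neg_one_mul, ← Real.log_inv]
        exact Real.log_le_log (inv_pos.2 (hmpos y 0 h0T))
          ((le_ciSup (hbdd' 0 h0T) y).trans (le_max_left _ _)))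
      (fun y => by
        rw [neg_one_mul, ← Real.log_inv]
        exact Real.log_le_log (inv_pos.2 (hmpos y T hTT))
          ((le_ciSup (hbdd' T hTT) y).trans (le_max_right _ _)))
      x t ht
    rw [neg_one_mul, ← Real.log_inv] at this
    exact (Real.log_le_log_iff (inv_pos.2 (hmpos x t ht)) hpos).1 this
end

section
/- Let R ≥ 1, T > 0, let f, g : (0,∞) → ℝ be C¹ with f' > 0 and g' ≥ 0 on (0,∞), and let (u,m) be a classical R-periodic solution of the 1D MFG system with coupling f on ℝ × [0,T] satisfying the terminal condition u(x,T) = g(m(x,T)) for all x ∈ ℝ. Write m₀ = m(·,0), and let min m₀ and max m₀ denote its infimum and supremum over ℝ (attained by periodicity). Then for every (x,t) ∈ ℝ × [0,T]: min m₀ ≤ m(x,T) ≤ max m₀, and f(min m₀)·(T−t) + g(min m₀) ≤ u(x,t) ≤ f(max m₀)·(T−t) + g(max m₀). -/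
open Set

/-- The closed space-time strip `ℝ × [0, T]`. -/
def strip (T : ℝ) : Set (ℝ × ℝ) := {p | p.2 ∈ Icc 0 T}

/-- Space derivative within the strip. -/
noncomputable def sdx (T : ℝ) (w : ℝ × ℝ → ℝ) (p : ℝ × ℝ) : ℝ :=
  fderivWithin ℝ w (strip T) p (1, 0)

/-- Time derivative within the strip. -/
noncomputable def sdt (T : ℝ) (w : ℝ × ℝ → ℝ) (p : ℝ × ℝ) : ℝ :=
  fderivWithin ℝ w (strip T) p (0, 1)

lemma strip_eq (T : ℝ) : strip T = univ ×ˢ Icc 0 T := by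
  ext p; simp [strip]

lemma strip_subset_closure_interior {T : ℝ} (hT : 0 < T) :
    strip T ⊆ closure (interior (strip T)) := by
  rw [strip_eq, interior_prod_eq, closure_prod_eq, interior_univ, closure_univ, interior_Icc,
    closure_Ioo hT.ne]

lemma uniqueDiffOn_strip {T : ℝ} (hT : 0 < T) : UniqueDiffOn ℝ (strip T) := by
  rw [strip_eq]
  exact uniqueDiffOn_univ.prod (uniqueDiffOn_Icc hT)

section Strip

variable {T : ℝ} {w : ℝ × ℝ → ℝ}

lemma contDiffOn_sdx (hT : 0 < T) (hw : ContDiffOn ℝ (⊤ : ℕ∞) w (strip T)) :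
    ContDiffOn ℝ (⊤ : ℕ∞) (sdx T w) (strip T) :=
  (hw.fderivWithin (uniqueDiffOn_strip hT) (by simp)).clm_apply contDiffOn_const

lemma contDiffOn_sdt (hT : 0 < T) (hw : ContDiffOn ℝ (⊤ : ℕ∞) w (strip T)) :
    ContDiffOn ℝ (⊤ : ℕ∞) (sdt T w) (strip T) :=
  (hw.fderivWithin (uniqueDiffOn_strip hT) (by simp)).clm_apply contDiffOn_const

lemma hasDerivAt_sdx (hw : ContDiffOn ℝ (⊤ : ℕ∞) w (strip T)) (x : ℝ) {t : ℝ}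
    (ht : t ∈ Icc 0 T) : HasDerivAt (fun y => w (y, t)) (sdx T w (x, t)) x := by
  have h1 : HasFDerivWithinAt w (fderivWithin ℝ w (strip T) (x, t)) (strip T) (x, t) :=
    ((hw.differentiableOn (by simp)) (x, t) ht).hasFDerivWithinAt
  have h2 : HasDerivAt (fun y : ℝ => (y, t)) ((1 : ℝ), (0 : ℝ)) x :=
    (hasDerivAt_id x).prodMk (hasDerivAt_const x t)
  exact HasFDerivWithinAt.comp_hasDerivAt x h1 h2 (Filter.Eventually.of_forall fun _ => ht)

lemma hasDerivAt_sdt (hw : ContDiffOn ℝ (⊤ : ℕ∞) w (strip T)) (x : ℝ) {t : ℝ}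
    (ht : t ∈ Ioo 0 T) : HasDerivAt (fun s => w (x, s)) (sdt T w (x, t)) t := by
  have h1 : HasFDerivWithinAt w (fderivWithin ℝ w (strip T) (x, t)) (strip T) (x, t) :=
    ((hw.differentiableOn (by simp)) (x, t) (Ioo_subset_Icc_self ht)).hasFDerivWithinAt
  have h2 : HasDerivAt (fun s : ℝ => (x, s)) ((0 : ℝ), (1 : ℝ)) t :=
    (hasDerivAt_const t x).prodMk (hasDerivAt_id t)
  refine HasFDerivWithinAt.comp_hasDerivAt t h1 h2 ?_
  filter_upwards [Icc_mem_nhds ht.1 ht.2] with s hs using hs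

lemma sdt_sdx_comm (hT : 0 < T) (hw : ContDiffOn ℝ (⊤ : ℕ∞) w (strip T)) {p : ℝ × ℝ}
    (hp : p ∈ strip T) : sdt T (sdx T w) p = sdx T (sdt T w) p := by
  have hd : DifferentiableWithinAt ℝ (fderivWithin ℝ w (strip T)) (strip T) p :=
    ((hw.fderivWithin (m := 1) (uniqueDiffOn_strip hT) (by norm_cast)).differentiableOn
      (by simp)) p hp
  have hsymm : IsSymmSndFDerivWithinAt ℝ w (strip T) p :=
    (hw p hp).isSymmSndFDerivWithinAt (by simp; norm_cast) (uniqueDiffOn_strip hT)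
      (strip_subset_closure_interior hT hp) hp
  have key : ∀ v e : ℝ × ℝ, fderivWithin ℝ (fun q => fderivWithin ℝ w (strip T) q v) (strip T) p e
      = fderivWithin ℝ (fderivWithin ℝ w (strip T)) (strip T) p e v := by
    intro v e
    rw [fderivWithin_clm_apply (uniqueDiffOn_strip hT p hp) hd (differentiableWithinAt_const v)]
    simp
  unfold sdt sdx
  rw [key, key]
  exact hsymm _ _

lemma continuous_slice (hw : ContinuousOn w (strip T)) {t : ℝ} (ht : t ∈ Icc 0 T) :
    Continuous fun x => w (x, t) :=
  hw.comp_continuous (by fun_prop) fun _ => ht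

lemma sdx_periodic {R : ℝ} (hw : ContDiffOn ℝ (⊤ : ℕ∞) w (strip T))
    (hper : ∀ x t : ℝ, t ∈ Icc 0 T → w (x + R, t) = w (x, t)) (x t : ℝ) (ht : t ∈ Icc 0 T) :
    sdx T w (x + R, t) = sdx T w (x, t) := by
  have h1 := (hasDerivAt_sdx hw (x + R) ht).comp_add_const x R
  simp only [hper _ t ht] at h1
  exact h1.unique (hasDerivAt_sdx hw x ht)

lemma sdt_periodic {R : ℝ} (hw : ContDiffOn ℝ (⊤ : ℕ∞) w (strip T))
    (hper : ∀ x t : ℝ, t ∈ Icc 0 T → w (x + R, t) = w (x, t)) (x t : ℝ) (ht : t ∈ Ioo 0 T) :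
    sdt T w (x + R, t) = sdt T w (x, t) := by
  refine (hasDerivAt_sdt hw (x + R) ht).unique ((hasDerivAt_sdt hw x ht).congr_of_eventuallyEq ?_)
  filter_upwards [Icc_mem_nhds ht.1 ht.2] with s hs using hper x s hs

lemma continuousOn_integral_strip {R : ℝ} (hT : 0 < T) (hw : ContinuousOn w (strip T)) :
    ContinuousOn (fun t => ∫ x in (0 : ℝ)..R, w (x, t)) (Icc 0 T) := by
  have h : Continuous fun t : ℝ => ∫ x in (0 : ℝ)..R, w (x, max 0 (min T t)) := by
    apply intervalIntegral.continuous_parametric_intervalIntegral_of_continuous'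
    exact hw.comp_continuous (f := fun p : ℝ × ℝ => (p.2, max 0 (min T p.1))) (by fun_prop)
      fun p => ⟨le_max_left _ _, max_le hT.le (min_le_left _ _)⟩
  refine h.continuousOn.congr fun t ht => ?_
  simp only [min_eq_right ht.2, max_eq_right ht.1]

lemma hasDerivAt_integral_strip {R : ℝ} {w' : ℝ × ℝ → ℝ} (hw : ContinuousOn w (strip T))
    (hw' : ContinuousOn w' (strip T))
    (hd : ∀ x t : ℝ, t ∈ Ioo 0 T → HasDerivAt (fun s => w (x, s)) (w' (x, t)) t)
    {t : ℝ} (ht : t ∈ Ioo 0 T) :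
    HasDerivAt (fun s => ∫ x in (0 : ℝ)..R, w (x, s)) (∫ x in (0 : ℝ)..R, w' (x, t)) t := by
  obtain ⟨C, hC⟩ := (isCompact_uIcc.prod isCompact_Icc).exists_bound_of_continuousOn
    (s := uIcc 0 R ×ˢ Icc 0 T) (hw'.mono fun p hp => hp.2)
  refine (intervalIntegral.hasDerivAt_integral_of_dominated_loc_of_deriv_le
    (F := fun s x => w (x, s)) (F' := fun s x => w' (x, s)) (bound := fun _ => C)
    (Ioo_mem_nhds ht.1 ht.2) ?_ ?_ ?_ ?_ ?_ ?_).2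
  · filter_upwards [Icc_mem_nhds ht.1 ht.2] with s hs
    exact (continuous_slice hw hs).aestronglyMeasurable
  · exact (continuous_slice hw (Ioo_subset_Icc_self ht)).intervalIntegrable _ _
  · exact (continuous_slice hw' (Ioo_subset_Icc_self ht)).aestronglyMeasurable
  · exact Filter.Eventually.of_forall fun x hx s hs =>
      hC (x, s) ⟨uIoc_subset_uIcc hx, Ioo_subset_Icc_self hs⟩
  · exact intervalIntegrable_const
  · exact Filter.Eventually.of_forall fun x _ s hs => hd x s hs

end Strip

lemma integral_nonneg_of_hasDerivAt_le {R : ℝ} (hR : 0 ≤ R) {F H H' : ℝ → ℝ} (hF : Continuous F)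
    (hH' : Continuous H') (hH : ∀ x, HasDerivAt H (H' x) x) (hper : H R = H 0)
    (hle : ∀ x, H' x ≤ F x) : 0 ≤ ∫ x in (0 : ℝ)..R, F x := by
  have h := intervalIntegral.integral_eq_sub_of_hasDerivAt (a := 0) (b := R) (fun x _ => hH x)
    (hH'.intervalIntegrable _ _)
  rw [hper, sub_self] at h
  refine h.ge.trans ?_
  exact intervalIntegral.integral_mono_on (μ := MeasureTheory.volume) hR
    (hH'.intervalIntegrable _ _) (hF.intervalIntegrable _ _) fun x _ => hle x

/-- Displacement convexity and the terminal condition make `∫ φ(m(·,t))` nonincreasing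
in time, for every convex `φ` with first and second derivatives `ψ` and `χ`. -/
lemma antitoneOn_integral_comp {R T : ℝ} (hR : 0 < R) (hT : 0 < T) {f g : ℝ → ℝ}
    (hf : DifferentiableOn ℝ f (Ioi 0)) (hg : DifferentiableOn ℝ g (Ioi 0))
    (hf' : ∀ s ∈ Ioi (0:ℝ), 0 < deriv f s) (hg' : ∀ s ∈ Ioi (0:ℝ), 0 ≤ deriv g s)
    {u m : ℝ × ℝ → ℝ}
    (hu : ContDiffOn ℝ (⊤ : ℕ∞) u (strip T)) (hm : ContDiffOn ℝ (⊤ : ℕ∞) m (strip T))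
    (huper : ∀ x t : ℝ, t ∈ Icc 0 T → u (x + R, t) = u (x, t))
    (hmper : ∀ x t : ℝ, t ∈ Icc 0 T → m (x + R, t) = m (x, t))
    (hmpos : ∀ x t : ℝ, t ∈ Icc 0 T → 0 < m (x, t))
    (hHJ : ∀ x t : ℝ, t ∈ Ioo 0 T →
      sdt T u (x, t) = (1/2) * (sdx T u (x, t))^2 - f (m (x, t)))
    (hCE : ∀ x t : ℝ, t ∈ Ioo 0 T →
      sdt T m (x, t) = sdx T m (x, t) * sdx T u (x, t) + m (x, t) * sdx T (sdx T u) (x, t))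
    (hterm : ∀ x : ℝ, u (x, T) = g (m (x, T)))
    {φ ψ χ : ℝ → ℝ} (hφ : ∀ s, HasDerivAt φ (ψ s) s) (hψ : ∀ s, HasDerivAt ψ (χ s) s)
    (hχ : Continuous χ) (hχ0 : ∀ s, 0 ≤ χ s) :
    AntitoneOn (fun t => ∫ x in (0 : ℝ)..R, φ (m (x, t))) (Icc 0 T) := by
  have hφc : Continuous φ := continuous_iff_continuousAt.2 fun s => (hφ s).continuousAt
  have hψc : Continuous ψ := continuous_iff_continuousAt.2 fun s => (hψ s).continuousAt
  obtain ⟨P, hP⟩ : ∃ P : ℝ → ℝ, P = fun s => s * ψ s - φ s := ⟨_, rfl⟩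
  have hPd : ∀ s, HasDerivAt P (s * χ s) s := fun s => by
    rw [hP]
    exact (((hasDerivAt_id s).mul (hψ s)).sub (hφ s)).congr_deriv (by simp)
  have hPc : Continuous P := continuous_iff_continuousAt.2 fun s => (hPd s).continuousAt
  have hux := contDiffOn_sdx hT hu
  have huxx := contDiffOn_sdx hT hux
  have hmc := hm.continuousOn
  have huxc := hux.continuousOn
  have huxxc := huxx.continuousOn
  have hmxc := (contDiffOn_sdx hT hm).continuousOn
  have hmtc := (contDiffOn_sdt hT hm).continuousOn
  have huxt := contDiffOn_sdt hT hux
  have huxtc := huxt.continuousOn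
  have huxxtc := (contDiffOn_sdt hT huxx).continuousOn
  -- the Hamilton-Jacobi equation differentiated in space
  have hHJx : ∀ x t : ℝ, t ∈ Ioo 0 T → sdt T (sdx T u) (x, t) =
      sdx T u (x, t) * sdx T (sdx T u) (x, t) - deriv f (m (x, t)) * sdx T m (x, t) := by
    intro x t ht
    have ht' := Ioo_subset_Icc_self ht
    rw [sdt_sdx_comm hT hu ht']
    have h1 := hasDerivAt_sdx (contDiffOn_sdt hT hu) x ht'
    simp only [hHJ _ t ht] at h1
    have hfm : HasDerivAt f (deriv f (m (x, t))) (m (x, t)) :=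
      ((hf _ (hmpos x t ht')).differentiableAt (Ioi_mem_nhds (hmpos x t ht'))).hasDerivAt
    have h2 := (((hasDerivAt_sdx hux x ht').pow 2).const_mul (1/2 : ℝ)).sub
      (hfm.comp x (hasDerivAt_sdx hm x ht'))
    rw [h1.unique h2]
    norm_num
    ring
  -- the first derivative of the entropy is the pressure integral `B`
  obtain ⟨B, hB⟩ : ∃ B : ℝ → ℝ,
    B = fun t => ∫ x in (0 : ℝ)..R, P (m (x, t)) * sdx T (sdx T u) (x, t) := ⟨_, rfl⟩
  have hBint : ContinuousOn (fun p => P (m p) * sdx T (sdx T u) p) (strip T) :=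
    (hPc.comp_continuousOn hmc).mul huxxc
  have hBd : ∀ t ∈ Ioo 0 T, ∃ b, 0 ≤ b ∧ HasDerivAt B b t := by
    intro t ht
    have ht' := Ioo_subset_Icc_self ht
    have hBt : ContinuousOn (fun p => m p * χ (m p) * sdt T m p * sdx T (sdx T u) p +
        P (m p) * sdt T (sdx T (sdx T u)) p) (strip T) :=
      (((hmc.mul (hχ.comp_continuousOn hmc)).mul hmtc).mul huxxc).add
        ((hPc.comp_continuousOn hmc).mul huxxtc)
    refine ⟨_, ?_, hB ▸ hasDerivAt_integral_strip hBint hBt (fun x s hs =>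
      ((hPd _).comp s (hasDerivAt_sdt hm x hs)).mul (hasDerivAt_sdt huxx x hs)) ht⟩
    refine integral_nonneg_of_hasDerivAt_le hR.le (continuous_slice hBt ht')
      (H := fun x => P (m (x, t)) * sdt T (sdx T u) (x, t))
      (H' := fun x => m (x, t) * χ (m (x, t)) * sdx T m (x, t) * sdt T (sdx T u) (x, t) +
        P (m (x, t)) * sdx T (sdt T (sdx T u)) (x, t)) ?_ (fun x =>
      ((hPd _).comp x (hasDerivAt_sdx hm x ht')).mul (hasDerivAt_sdx huxt x ht')) ?_ ?_
    · exact continuous_slice ((((hmc.mul (hχ.comp_continuousOn hmc)).mul hmxc).mul huxtc).add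
        ((hPc.comp_continuousOn hmc).mul (contDiffOn_sdx hT huxt).continuousOn)) ht'
    · have h1 := hmper 0 t ht'
      have h2 := sdt_periodic hux (sdx_periodic hu huper) 0 t ht
      rw [zero_add] at h1 h2
      simp only [h1, h2]
    · intro x
      rw [sdt_sdx_comm hT hux (show (x, t) ∈ strip T from ht'), hCE x t ht, hHJx x t ht]
      have h0 : 0 ≤ m (x, t) * χ (m (x, t)) * (m (x, t) * (sdx T (sdx T u) (x, t)) ^ 2 +
          deriv f (m (x, t)) * (sdx T m (x, t)) ^ 2) := by
        have := hmpos x t ht'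
        have := hf' _ this
        have := hχ0 (m (x, t))
        positivity
      linarith
  have hBc : ContinuousOn B (Icc 0 T) := hB ▸ continuousOn_integral_strip hT hBint
  have hTT : T ∈ Icc 0 T := right_mem_Icc.2 hT.le
  have hBmono : MonotoneOn B (Icc 0 T) := by
    refine monotoneOn_of_deriv_nonneg (convex_Icc 0 T) hBc ?_ ?_
    · rw [interior_Icc]
      intro t ht
      obtain ⟨b, -, hb⟩ := hBd t ht
      exact hb.differentiableAt.differentiableWithinAt
    · rw [interior_Icc]
      intro t ht
      obtain ⟨b, hb0, hb⟩ := hBd t ht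
      rwa [hb.deriv]
  have hBT : B T ≤ 0 := by
    have hgx : ∀ x, sdx T u (x, T) = deriv g (m (x, T)) * sdx T m (x, T) := by
      intro x
      have h1 := hasDerivAt_sdx hu x hTT
      simp only [hterm] at h1
      exact h1.unique (((hg _ (hmpos x T hTT)).differentiableAt
        (Ioi_mem_nhds (hmpos x T hTT))).hasDerivAt.comp x (hasDerivAt_sdx hm x hTT))
    have h : 0 ≤ ∫ x in (0 : ℝ)..R, -(P (m (x, T)) * sdx T (sdx T u) (x, T)) := by
      refine integral_nonneg_of_hasDerivAt_le hR.le (continuous_slice hBint hTT).neg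
        (H := fun x => -(P (m (x, T)) * sdx T u (x, T)))
        (H' := fun x => -(m (x, T) * χ (m (x, T)) * sdx T m (x, T) * sdx T u (x, T) +
          P (m (x, T)) * sdx T (sdx T u) (x, T))) ?_ (fun x =>
        (((hPd _).comp x (hasDerivAt_sdx hm x hTT)).mul (hasDerivAt_sdx hux x hTT)).neg) ?_ ?_
      · exact (continuous_slice ((((hmc.mul (hχ.comp_continuousOn hmc)).mul hmxc).mul huxc).add
          ((hPc.comp_continuousOn hmc).mul huxxc)) hTT).neg
      · have h1 := hmper 0 T hTT
        have h2 := sdx_periodic hu huper 0 T hTT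
        rw [zero_add] at h1 h2
        simp only [h1, h2]
      · intro x
        have h0 : 0 ≤ m (x, T) * χ (m (x, T)) * sdx T m (x, T) * sdx T u (x, T) := by
          rw [hgx x]
          have := hmpos x T hTT
          have := hg' _ this
          have := hχ0 (m (x, T))
          calc (0 : ℝ) ≤ m (x, T) * χ (m (x, T)) * deriv g (m (x, T)) * (sdx T m (x, T)) ^ 2 := by
                positivity
            _ = _ := by ring
        linarith
    rw [intervalIntegral.integral_neg] at h
    rw [hB]
    linarith
  have hAint : ContinuousOn (fun p => φ (m p)) (strip T) := hφc.comp_continuousOn hmc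
  have hAd : ∀ t ∈ Ioo 0 T, ∃ a, a ≤ 0 ∧
      HasDerivAt (fun s => ∫ x in (0 : ℝ)..R, φ (m (x, s))) a t := by
    intro t ht
    have ht' := Ioo_subset_Icc_self ht
    have hAt : ContinuousOn (fun p => ψ (m p) * sdt T m p) (strip T) :=
      (hψc.comp_continuousOn hmc).mul hmtc
    refine ⟨_, ?_, hasDerivAt_integral_strip hAint hAt (fun x s hs =>
      (hφ _).comp s (hasDerivAt_sdt hm x hs)) ht⟩
    have hle : 0 ≤ ∫ x in (0 : ℝ)..R, (P (m (x, t)) * sdx T (sdx T u) (x, t) -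
        ψ (m (x, t)) * sdt T m (x, t)) := by
      refine integral_nonneg_of_hasDerivAt_le hR.le
        ((continuous_slice hBint ht').sub (continuous_slice hAt ht'))
        (H := fun x => -(φ (m (x, t)) * sdx T u (x, t)))
        (H' := fun x => -(ψ (m (x, t)) * sdx T m (x, t) * sdx T u (x, t) +
          φ (m (x, t)) * sdx T (sdx T u) (x, t))) ?_ (fun x =>
        (((hφ _).comp x (hasDerivAt_sdx hm x ht')).mul (hasDerivAt_sdx hux x ht')).neg) ?_ ?_
      · exact (continuous_slice ((((hψc.comp_continuousOn hmc).mul hmxc).mul huxc).add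
          (hAint.mul huxxc)) ht').neg
      · have h1 := hmper 0 t ht'
        have h2 := sdx_periodic hu huper 0 t ht'
        rw [zero_add] at h1 h2
        simp only [h1, h2]
      · intro x
        rw [hCE x t ht, hP]
        apply le_of_eq
        ring
    rw [intervalIntegral.integral_sub ((continuous_slice hBint ht').intervalIntegrable _ _)
      ((continuous_slice hAt ht').intervalIntegrable _ _)] at hle
    have h2 := hBmono ht' hTT ht'.2
    rw [hB] at h2 hBT
    simp only at h2 hBT
    linarith
  refine antitoneOn_of_deriv_nonpos (convex_Icc 0 T) (continuousOn_integral_strip hT hAint) ?_ ?_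
  · rw [interior_Icc]
    intro t ht
    obtain ⟨a, -, ha⟩ := hAd t ht
    exact ha.differentiableAt.differentiableWithinAt
  · rw [interior_Icc]
    intro t ht
    obtain ⟨a, ha0, ha⟩ := hAd t ht
    rwa [ha.deriv]

lemma hasDerivAt_posPart_pow (n : ℕ) (s : ℝ) :
    HasDerivAt (fun r : ℝ => max r 0 ^ (n + 2)) ((n + 2) * max s 0 ^ (n + 1)) s := by
  rcases lt_trichotomy s 0 with hs | rfl | hs
  · rw [max_eq_right hs.le, zero_pow (by omega), mul_zero]
    refine (hasDerivAt_const s (0 : ℝ)).congr_of_eventuallyEq ?_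
    filter_upwards [Iio_mem_nhds hs] with r hr
    rw [max_eq_right (le_of_lt hr), zero_pow (by omega)]
  · simp only [max_self, zero_pow (Nat.succ_ne_zero n), mul_zero]
    rw [hasDerivAt_iff_isLittleO_nhds_zero]
    refine Asymptotics.IsBigO.trans_isLittleO (g := fun h : ℝ => h ^ (n + 2)) ?_ ?_
    · refine Asymptotics.IsBigO.of_bound 1 (Filter.Eventually.of_forall fun h => ?_)
      simp only [zero_add, max_self, smul_zero, sub_zero, one_mul, norm_pow, Real.norm_eq_abs,
        ne_eq, Nat.add_eq_zero_iff, OfNat.ofNat_ne_zero, and_false, not_false_eq_true, zero_pow]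
      gcongr ?_ ^ _
      rw [abs_of_nonneg (le_max_right _ _)]
      exact max_le (le_abs_self h) (abs_nonneg h)
    · exact Asymptotics.isLittleO_pow_id (by omega)
  · rw [max_eq_left hs.le]
    have h := hasDerivAt_pow (n + 2) s
    push_cast at h
    refine h.congr_of_eventuallyEq ?_
    filter_upwards [Ioi_mem_nhds hs] with r hr
    rw [max_eq_left (le_of_lt hr)]

/-- If the entropy `∫ φ(m(·,t))` of a nonnegative `φ` is nonincreasing and vanishes pointwise
initially, it vanishes pointwise at all times. -/
lemma eq_zero_of_antitoneOn_integral {R T : ℝ} (hR : 0 < R) (hT : 0 < T) {w : ℝ × ℝ → ℝ}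
    (hw : ContinuousOn w (strip T))
    (hper : ∀ x t : ℝ, t ∈ Icc 0 T → w (x + R, t) = w (x, t))
    (hnn : ∀ p, 0 ≤ w p) (h0 : ∀ x, w (x, 0) = 0)
    (hanti : AntitoneOn (fun t => ∫ x in (0 : ℝ)..R, w (x, t)) (Icc 0 T))
    (x : ℝ) {t : ℝ} (ht : t ∈ Icc 0 T) : w (x, t) = 0 := by
  have hint := hanti (left_mem_Icc.2 hT.le) ht ht.1
  simp only [h0, intervalIntegral.integral_zero] at hint
  have hp : Function.Periodic (fun y => w (y, t)) R := fun y => hper y t ht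
  obtain ⟨y, hy, hxy⟩ := hp.exists_mem_Ico₀ hR x
  refine hxy.trans ?_
  by_contra hne
  have := intervalIntegral.integral_pos hR (continuous_slice hw ht).continuousOn
    (fun z _ => hnn (z, t)) ⟨y, Ico_subset_Icc_self hy, lt_of_le_of_ne (hnn _) (Ne.symm hne)⟩
  linarith

lemma nonneg_of_hasDerivAt_of_le_right {h : ℝ → ℝ} {h' a b : ℝ} (hab : a < b)
    (hd : HasDerivAt h h' a) (hle : ∀ s ∈ Ioo a b, h a ≤ h s) : 0 ≤ h' := by
  have ht := (hasDerivWithinAt_iff_tendsto_slope' (by simp)).1 (hd.hasDerivWithinAt (s := Ioi a))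
  refine ge_of_tendsto ht ?_
  filter_upwards [Ioo_mem_nhdsGT hab] with s hs
  rw [slope_def_field]
  exact div_nonneg (sub_nonneg.2 (hle s hs)) (sub_nonneg.2 hs.1.le)

/-- Minimum principle for supersolutions of the Hamilton-Jacobi equation. -/
lemma le_of_hamiltonJacobi_supersolution {R T : ℝ} (hR : 0 < R) (hT : 0 < T) {u : ℝ × ℝ → ℝ}
    (hu : ContDiffOn ℝ (⊤ : ℕ∞) u (strip T))
    (hper : ∀ x t : ℝ, t ∈ Icc 0 T → u (x + R, t) = u (x, t)) {c d : ℝ}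
    (hsup : ∀ x t : ℝ, t ∈ Ioo 0 T → c ≤ -sdt T u (x, t) + (1/2) * (sdx T u (x, t))^2)
    (hd : ∀ x, d ≤ u (x, T)) (x : ℝ) {t : ℝ} (ht : t ∈ Icc 0 T) :
    c * (T - t) + d ≤ u (x, t) := by
  have huc := hu.continuousOn
  have key : ∀ ε > 0, ∀ t₁ ∈ Ioo 0 T, (c - ε) * (T - t₁) + d ≤ u (x, t₁) := by
    intro ε hε t₁ ht₁
    obtain ⟨w, hw⟩ : ∃ w : ℝ × ℝ → ℝ, w = fun p => u p - ((c - ε) * (T - p.2) + d) := ⟨_, rfl⟩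
    have hsub : Icc t₁ T ⊆ Icc 0 T := Icc_subset_Icc_left ht₁.1.le
    have hwc : ContinuousOn w (Icc 0 R ×ˢ Icc t₁ T) := by
      rw [hw]
      exact (huc.mono fun p hp => hsub hp.2).sub (by fun_prop)
    obtain ⟨⟨x₀, t₀⟩, hp₀, hmin⟩ := (isCompact_Icc.prod isCompact_Icc).exists_isMinOn
      ⟨((0 : ℝ), t₁), left_mem_Icc.2 hR.le, left_mem_Icc.2 ht₁.2.le⟩ hwc
    have hmin' : ∀ y, ∀ s ∈ Icc t₁ T, w (x₀, t₀) ≤ w (y, s) := by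
      intro y s hs
      have hp : Function.Periodic (fun y => w (y, s)) R := fun y => by
        simp only [hw, hper y s (hsub hs)]
      obtain ⟨z, hz, hyz⟩ := hp.exists_mem_Ico₀ hR y
      refine le_of_le_of_eq ?_ hyz.symm
      exact hmin ⟨Ico_subset_Icc_self hz, hs⟩
    have hpos : 0 ≤ w (x₀, t₀) := by
      rcases hp₀.2.2.eq_or_lt with h | h
      · simp only at h
        rw [h, hw]
        simpa using hd x₀
      · exfalso
        have ht₀ : t₀ ∈ Ioo 0 T := ⟨ht₁.1.trans_le hp₀.2.1, h⟩
        have hx : sdx T u (x₀, t₀) = 0 := by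
          have hloc : IsLocalMin (fun y => u (y, t₀)) x₀ :=
            Filter.Eventually.of_forall fun y => by
              have := hmin' y t₀ hp₀.2
              simp only [hw] at this
              linarith
          exact hloc.hasDerivAt_eq_zero (hasDerivAt_sdx hu x₀ (Ioo_subset_Icc_self ht₀))
        have htd : HasDerivAt (fun s => w (x₀, s)) (sdt T u (x₀, t₀) + (c - ε)) t₀ := by
          rw [hw]
          exact ((hasDerivAt_sdt hu x₀ ht₀).sub
            ((((hasDerivAt_id t₀).const_sub T).const_mul (c - ε)).add_const d)).congr_deriv
            (by ring)
        have h1 := nonneg_of_hasDerivAt_of_le_right h htd fun s hs =>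
          hmin' x₀ s ⟨hp₀.2.1.trans hs.1.le, hs.2.le⟩
        have h2 := hsup x₀ t₀ ht₀
        rw [hx] at h2
        linarith
    have h3 := hpos.trans (hmin' x t₁ (left_mem_Icc.2 ht₁.2.le))
    simp only [hw] at h3
    linarith
  have key' : ∀ t₁ ∈ Ioo 0 T, c * (T - t₁) + d ≤ u (x, t₁) := by
    intro t₁ ht₁
    have hTt : 0 < T - t₁ := sub_pos.2 ht₁.2
    refine le_of_forall_pos_le_add fun δ hδ => ?_
    have := key (δ / (T - t₁)) (div_pos hδ hTt) t₁ ht₁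
    rw [sub_mul, div_mul_cancel₀ _ hTt.ne'] at this
    linarith
  have hcl : t ∈ closure (Ioo 0 T) := by rwa [closure_Ioo hT.ne]
  have hut : ContinuousOn (fun s => u (x, s)) (Icc 0 T) :=
    huc.comp (by fun_prop) fun s hs => hs
  exact ContinuousWithinAt.closure_le hcl (Continuous.continuousWithinAt (by fun_prop))
    ((hut t ht).mono Ioo_subset_Icc_self) key'

lemma le_of_hamiltonJacobi_subsolution {T : ℝ} (hT : 0 < T) {u : ℝ × ℝ → ℝ}
    (hu : ContDiffOn ℝ (⊤ : ℕ∞) u (strip T)) {c d : ℝ}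
    (hsub : ∀ x t : ℝ, t ∈ Ioo 0 T → -sdt T u (x, t) + (1/2) * (sdx T u (x, t))^2 ≤ c)
    (hd : ∀ x, u (x, T) ≤ d) (x : ℝ) {t : ℝ} (ht : t ∈ Icc 0 T) :
    u (x, t) ≤ c * (T - t) + d := by
  have hder : ∀ s ∈ Ioo 0 T,
      HasDerivAt (fun s => u (x, s) + c * s) (sdt T u (x, s) + c) s := fun s hs =>
    ((hasDerivAt_sdt hu x hs).add ((hasDerivAt_id s).const_mul c)).congr_deriv (by ring)
  have hmono : MonotoneOn (fun s => u (x, s) + c * s) (Icc 0 T) := by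
    refine monotoneOn_of_deriv_nonneg (convex_Icc 0 T) ?_ ?_ ?_
    · exact (hu.continuousOn.comp (f := fun s => (x, s)) (by fun_prop) fun s hs => hs).add
        (by fun_prop)
    · rw [interior_Icc]
      exact fun s hs => (hder s hs).differentiableAt.differentiableWithinAt
    · rw [interior_Icc]
      intro s hs
      rw [(hder s hs).deriv]
      have := hsub x s hs
      nlinarith [sq_nonneg (sdx T u (x, s))]
  have h := hmono ht (right_mem_Icc.2 hT.le) ht.2
  simp only at h
  linarith [hd x]

/-- Bounds for the terminal-cost problem: for a classical `R`-periodic solution `(u, m)` of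
the 1D MFG system with coupling `f` (with `f' > 0`, `g' ≥ 0`) and terminal condition
`u(·,T) = g(m(·,T))`, writing `m₀ = m(·,0)`, one has
`min m₀ ≤ m(x,T) ≤ max m₀` and
`f(min m₀)(T−t) + g(min m₀) ≤ u(x,t) ≤ f(max m₀)(T−t) + g(max m₀)`. -/
theorem stmt5
    (R T : ℝ) (hR : 1 ≤ R) (hT : 0 < T)
    (f g : ℝ → ℝ)
    (hf : ContDiffOn ℝ 1 f (Ioi 0)) (hg : ContDiffOn ℝ 1 g (Ioi 0))
    (hf' : ∀ s ∈ Ioi (0:ℝ), 0 < deriv f s)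
    (hg' : ∀ s ∈ Ioi (0:ℝ), 0 ≤ deriv g s)
    (u m : ℝ → ℝ → ℝ)
    (hu : ContDiffOn ℝ (⊤ : ℕ∞) (fun p : ℝ × ℝ => u p.1 p.2) {p : ℝ × ℝ | p.2 ∈ Icc 0 T})
    (hm : ContDiffOn ℝ (⊤ : ℕ∞) (fun p : ℝ × ℝ => m p.1 p.2) {p : ℝ × ℝ | p.2 ∈ Icc 0 T})
    (huper : ∀ x t : ℝ, t ∈ Icc 0 T → u (x + R) t = u x t)
    (hmper : ∀ x t : ℝ, t ∈ Icc 0 T → m (x + R) t = m x t)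
    (hmpos : ∀ x t : ℝ, t ∈ Icc 0 T → 0 < m x t)
    (hHJ : ∀ x t : ℝ, t ∈ Icc 0 T →
      -pdt u x t + (1/2) * (pdx u x t)^2 = f (m x t))
    (hCE : ∀ x t : ℝ, t ∈ Icc 0 T →
      pdt m x t - pdx (fun y s => m y s * pdx u y s) x t = 0)
    (hterm : ∀ x : ℝ, u x T = g (m x T)) :
    ∀ x t : ℝ, t ∈ Icc 0 T →
      ((⨅ y : ℝ, m y 0) ≤ m x T ∧ m x T ≤ (⨆ y : ℝ, m y 0)) ∧
      (f (⨅ y : ℝ, m y 0) * (T - t) + g (⨅ y : ℝ, m y 0) ≤ u x t ∧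
        u x t ≤ f (⨆ y : ℝ, m y 0) * (T - t) + g (⨆ y : ℝ, m y 0)) := by
  have hR0 : 0 < R := by linarith
  have h0T : (0 : ℝ) ∈ Icc 0 T := left_mem_Icc.2 hT.le
  have hTT : T ∈ Icc 0 T := right_mem_Icc.2 hT.le
  obtain ⟨U, hU⟩ : ∃ U : ℝ × ℝ → ℝ, U = fun p => u p.1 p.2 := ⟨_, rfl⟩
  obtain ⟨M, hM⟩ : ∃ M : ℝ × ℝ → ℝ, M = fun p => m p.1 p.2 := ⟨_, rfl⟩
  have hUe : ∀ x t, U (x, t) = u x t := fun x t => by rw [hU]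
  have hMe : ∀ x t, M (x, t) = m x t := fun x t => by rw [hM]
  have hUs : ContDiffOn ℝ (⊤ : ℕ∞) U (strip T) := hU ▸ hu
  have hMs : ContDiffOn ℝ (⊤ : ℕ∞) M (strip T) := hM ▸ hm
  simp only [← hUe] at huper hterm
  simp only [← hMe] at hmper hmpos hterm
  have hUx : ∀ x, ∀ t ∈ Icc 0 T, pdx u x t = sdx T U (x, t) := fun x t ht => by
    have h := (hasDerivAt_sdx hUs x ht).deriv
    simp only [hUe] at h
    exact h
  have hUt : ∀ x, ∀ t ∈ Ioo 0 T, pdt u x t = sdt T U (x, t) := fun x t ht => by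
    have h := (hasDerivAt_sdt hUs x ht).deriv
    simp only [hUe] at h
    exact h
  have hMt : ∀ x, ∀ t ∈ Ioo 0 T, pdt m x t = sdt T M (x, t) := fun x t ht => by
    have h := (hasDerivAt_sdt hMs x ht).deriv
    simp only [hMe] at h
    exact h
  have hHJ' : ∀ x t : ℝ, t ∈ Ioo 0 T →
      -sdt T U (x, t) + (1/2) * (sdx T U (x, t))^2 = f (M (x, t)) := fun x t ht => by
    rw [← hUt x t ht, ← hUx x t (Ioo_subset_Icc_self ht), hMe]
    exact hHJ x t (Ioo_subset_Icc_self ht)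
  have hCE' : ∀ x t : ℝ, t ∈ Ioo 0 T → sdt T M (x, t) =
      sdx T M (x, t) * sdx T U (x, t) + M (x, t) * sdx T (sdx T U) (x, t) := fun x t ht => by
    have ht' := Ioo_subset_Icc_self ht
    have h : HasDerivAt (fun y => m y t * pdx u y t)
        (sdx T M (x, t) * sdx T U (x, t) + M (x, t) * sdx T (sdx T U) (x, t)) x := by
      simp only [hUx _ t ht', ← hMe]
      exact (hasDerivAt_sdx hMs x ht').mul (hasDerivAt_sdx (contDiffOn_sdx hT hUs) x ht')
    have hce := hCE x t ht'
    rw [hMt x t ht, pdx, h.deriv] at hce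
    linarith
  have hMc := hMs.continuousOn
  -- attained extrema of the initial density
  have hcomp : IsCompact (range fun y => m y 0) := by
    have hp : Function.Periodic (fun y => M (y, 0)) R := fun y => hmper y 0 h0T
    simpa only [hMe] using hp.compact_of_continuous hR0.ne' (continuous_slice hMc h0T)
  obtain ⟨a, ha⟩ : ∃ a, a = ⨅ y : ℝ, m y 0 := ⟨_, rfl⟩
  obtain ⟨b, hb⟩ : ∃ b, b = ⨆ y : ℝ, m y 0 := ⟨_, rfl⟩
  rw [← ha, ← hb]
  have ha0 : 0 < a := by
    obtain ⟨y, hy⟩ : a ∈ range fun y => m y 0 := ha ▸ hcomp.sInf_mem (range_nonempty _)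
    rw [← hy]
    simpa only [hMe] using hmpos y 0 h0T
  have hma : ∀ y, a ≤ M (y, 0) := fun y => by
    rw [ha, hMe]
    exact ciInf_le hcomp.bddBelow y
  have hmb : ∀ y, M (y, 0) ≤ b := fun y => by
    rw [hb, hMe]
    exact le_ciSup hcomp.bddAbove y
  have hb0 : 0 < b := ha0.trans_le ((hma 0).trans (hmb 0))
  have hfd := hf.differentiableOn (by simp)
  have hgd := hg.differentiableOn (by simp)
  have hzero : ∀ φ ψ χ : ℝ → ℝ, (∀ s, HasDerivAt φ (ψ s) s) → (∀ s, HasDerivAt ψ (χ s) s) →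
      Continuous χ → (∀ s, 0 ≤ χ s) → (∀ s, 0 ≤ φ s) → (∀ y, φ (M (y, 0)) = 0) →
      ∀ x, ∀ t ∈ Icc 0 T, φ (M (x, t)) = 0 := by
    intro φ ψ χ hφ hψ hχ hχ0 hφ0 hφM x t ht
    have hφc : Continuous φ := continuous_iff_continuousAt.2 fun s => (hφ s).continuousAt
    exact eq_zero_of_antitoneOn_integral hR0 hT (w := fun p => φ (M p))
      (hφc.comp_continuousOn hMc) (fun x t ht => by simp only [hmper x t ht]) (fun p => hφ0 _) hφM
      (antitoneOn_integral_comp hR0 hT hfd hgd hf' hg' hUs hMs huper hmper hmpos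
        (fun x t ht => by linarith [hHJ' x t ht]) hCE' hterm hφ hψ hχ hχ0) x ht
  have hpp := hasDerivAt_posPart_pow
  have hMb : ∀ x, ∀ t ∈ Icc 0 T, M (x, t) ≤ b := fun x t ht => by
    have h := hzero (fun s => max (s - b) 0 ^ 3) (fun s => 3 * max (s - b) 0 ^ 2)
      (fun s => 6 * max (s - b) 0)
      (fun s => ((hpp 1 (s - b)).comp s ((hasDerivAt_id s).sub_const b)).congr_deriv
        (by norm_num))
      (fun s => (((hpp 0 (s - b)).comp s ((hasDerivAt_id s).sub_const b)).const_mul 3).congr_deriv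
        (by norm_num; ring))
      (by fun_prop) (fun s => by positivity) (fun s => by positivity)
      (fun y => by simp [hmb y]) x t ht
    simpa using h
  have hMa : ∀ x, ∀ t ∈ Icc 0 T, a ≤ M (x, t) := fun x t ht => by
    have h := hzero (fun s => max (a - s) 0 ^ 3) (fun s => -3 * max (a - s) 0 ^ 2)
      (fun s => 6 * max (a - s) 0)
      (fun s => ((hpp 1 (a - s)).comp s ((hasDerivAt_id s).const_sub a)).congr_deriv
        (by norm_num))
      (fun s => (((hpp 0 (a - s)).comp s ((hasDerivAt_id s).const_sub a)).const_mul
        (-3)).congr_deriv (by norm_num; ring))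
      (by fun_prop) (fun s => by positivity) (fun s => by positivity)
      (fun y => by simp [hma y]) x t ht
    simpa using h
  have hfm : MonotoneOn f (Ioi 0) := (strictMonoOn_of_deriv_pos (convex_Ioi 0) hfd.continuousOn
    (by rwa [interior_Ioi])).monotoneOn
  have hgm : MonotoneOn g (Ioi 0) := monotoneOn_of_deriv_nonneg (convex_Ioi 0) hgd.continuousOn
    (by rwa [interior_Ioi]) (by rwa [interior_Ioi])
  intro x t ht
  rw [← hMe, ← hUe]
  refine ⟨⟨hMa x T hTT, hMb x T hTT⟩, ?_, ?_⟩
  · refine le_of_hamiltonJacobi_supersolution hR0 hT hUs huper (fun y s hs => ?_) (fun y => ?_) x ht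
    · have hs' := Ioo_subset_Icc_self hs
      rw [hHJ' y s hs]
      exact hfm ha0 (hmpos y s hs') (hMa y s hs')
    · rw [hterm]
      exact hgm ha0 (hmpos y T hTT) (hMa y T hTT)
  · refine le_of_hamiltonJacobi_subsolution hT hUs (fun y s hs => ?_) (fun y => ?_) x ht
    · have hs' := Ioo_subset_Icc_self hs
      rw [hHJ' y s hs]
      exact hfm (hmpos y s hs') hb0 (hMb y s hs')
    · rw [hterm]
      exact hgm (hmpos y T hTT) hb0 (hMb y T hTT)
end

section
/- For every κ₀ > 0, R ≥ 1, T > 0 and M > 0 there exists a constant C > 0 (depending only on κ₀, R, T, 1/T and M) with the following property. Let f : (0,∞) → ℝ be C² with f' > 0 on (0,∞), and let (u,m) be a classical R-periodic solution of the 1D MFG system with coupling f on ℝ × [0,T]. Assume that s·f'(s) ≤ κ₀ and s·|f''(s)|/f'(s) ≤ κ₀ for every s ∈ (0, 2·max( sup_x m(x,0), sup_x m(x,T) )], and that sup_x |f(m(x,0))| + sup_x |∂_x( f(m(·,0)) )(x)| ≤ M and sup_x |f(m(x,T))| + sup_x |∂_x( f(m(·,T)) )(x)| ≤ M. Then sup_{(x,t)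 ∈ ℝ×[0,T]} ( |∂_x u(x,t)| + |∂_t u(x,t)| ) ≤ C. -/
open Set

open Filter Topology

/-- Joint smoothness on the open strip `ℝ × (0, T)`. -/
def SmoothOnStrip (T : ℝ) (g : ℝ → ℝ → ℝ) : Prop :=
  ContDiffOn ℝ (⊤ : ℕ∞) (fun p : ℝ × ℝ => g p.1 p.2) {p : ℝ × ℝ | p.2 ∈ Ioo 0 T}

lemma isOpen_strip (T : ℝ) : IsOpen {p : ℝ × ℝ | p.2 ∈ Ioo 0 T} :=
  isOpen_Ioo.preimage continuous_snd

namespace SmoothOnStrip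

variable {T : ℝ} {g : ℝ → ℝ → ℝ}

lemma contDiffAt (hg : SmoothOnStrip T g) {x t : ℝ} (ht : t ∈ Ioo 0 T) :
    ContDiffAt ℝ (⊤ : ℕ∞) (fun p : ℝ × ℝ => g p.1 p.2) (x, t) :=
  ContDiffOn.contDiffAt hg ((isOpen_strip T).mem_nhds ht)

lemma hasFDerivAt (hg : SmoothOnStrip T g) {x t : ℝ} (ht : t ∈ Ioo 0 T) :
    HasFDerivAt (fun p : ℝ × ℝ => g p.1 p.2)
      (fderiv ℝ (fun p : ℝ × ℝ => g p.1 p.2) (x, t)) (x, t) :=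
  ((hg.contDiffAt ht).differentiableAt (by simp)).hasFDerivAt

lemma pdx_eq (hg : SmoothOnStrip T g) {x t : ℝ} (ht : t ∈ Ioo 0 T) :
    pdx g x t = fderiv ℝ (fun p : ℝ × ℝ => g p.1 p.2) (x, t) (1, 0) := by
  have h := (hg.hasFDerivAt (x := x) ht).comp_hasDerivAt x
    ((hasDerivAt_id x).prodMk (hasDerivAt_const x t))
  exact h.deriv

lemma pdt_eq (hg : SmoothOnStrip T g) {x t : ℝ} (ht : t ∈ Ioo 0 T) :
    pdt g x t = fderiv ℝ (fun p : ℝ × ℝ => g p.1 p.2) (x, t) (0, 1) := by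
  have h := (hg.hasFDerivAt (x := x) ht).comp_hasDerivAt t
    ((hasDerivAt_const t x).prodMk (hasDerivAt_id t))
  exact h.deriv

lemma hasDerivAt_line (hg : SmoothOnStrip T g) (x t α β : ℝ) {r : ℝ} (ht : t + β * r ∈ Ioo 0 T) :
    HasDerivAt (fun r => g (x + α * r) (t + β * r))
      (α * pdx g (x + α * r) (t + β * r) + β * pdt g (x + α * r) (t + β * r)) r := by
  have h := (hg.hasFDerivAt (x := x + α * r) ht).comp_hasDerivAt r
    ((((hasDerivAt_id r).const_mul α).const_add x).prodMk
      (((hasDerivAt_id r).const_mul β).const_add t))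
  rw [hg.pdx_eq ht, hg.pdt_eq ht]
  refine h.congr_deriv ?_
  have hv : ((α * 1, β * 1) : ℝ × ℝ) = α • ((1, 0) : ℝ × ℝ) + β • ((0, 1) : ℝ × ℝ) := by simp
  rw [hv, map_add, map_smul, map_smul, smul_eq_mul, smul_eq_mul]

lemma hasDerivAt_fst (hg : SmoothOnStrip T g) {x t : ℝ} (ht : t ∈ Ioo 0 T) :
    HasDerivAt (fun y => g y t) (pdx g x t) x := by
  simpa using hg.hasDerivAt_line 0 t 1 0 (r := x) (by simpa using ht)

lemma hasDerivAt_snd (hg : SmoothOnStrip T g) {x t : ℝ} (ht : t ∈ Ioo 0 T) :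
    HasDerivAt (fun s => g x s) (pdt g x t) t := by
  simpa using hg.hasDerivAt_line x 0 0 1 (r := t) (by simpa using ht)

lemma smoothOnStrip_pdx (hg : SmoothOnStrip T g) : SmoothOnStrip T (pdx g) := by
  have h := (ContDiffOn.fderiv_of_isOpen hg (isOpen_strip T) (m := (⊤ : ℕ∞)) (by simp)).clm_apply
    (contDiffOn_const (c := ((1, 0) : ℝ × ℝ)))
  exact h.congr fun p hp => hg.pdx_eq hp

lemma smoothOnStrip_pdt (hg : SmoothOnStrip T g) : SmoothOnStrip T (pdt g) := by
  have h := (ContDiffOn.fderiv_of_isOpen hg (isOpen_strip T) (m := (⊤ : ℕ∞)) (by simp)).clm_apply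
    (contDiffOn_const (c := ((0, 1) : ℝ × ℝ)))
  exact h.congr fun p hp => hg.pdt_eq hp

lemma hasFDerivAt_fderiv_apply (hg : SmoothOnStrip T g) {x t : ℝ} (ht : t ∈ Ioo 0 T) (v : ℝ × ℝ) :
    HasFDerivAt (fun q => fderiv ℝ (fun p : ℝ × ℝ => g p.1 p.2) q v)
      ((fderiv ℝ (fderiv ℝ (fun p : ℝ × ℝ => g p.1 p.2)) (x, t)).flip v) (x, t) := by
  have h1 : ContDiffAt ℝ 1 (fderiv ℝ (fun p : ℝ × ℝ => g p.1 p.2)) (x, t) :=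
    (hg.contDiffAt ht).fderiv_right (WithTop.coe_le_coe.2 le_top)
  have h2 := (h1.differentiableAt one_ne_zero).hasFDerivAt.clm_apply
    (hasFDerivAt_const v ((x, t) : ℝ × ℝ))
  simpa using h2

lemma pdx_pdt_comm (hg : SmoothOnStrip T g) {x t : ℝ} (ht : t ∈ Ioo 0 T) :
    pdt (pdx g) x t = pdx (pdt g) x t := by
  have hs : IsSymmSndFDerivAt ℝ (fun p : ℝ × ℝ => g p.1 p.2) (x, t) :=
    (hg.contDiffAt ht).isSymmSndFDerivAt (by simp; exact WithTop.coe_le_coe.2 le_top)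
  have hm : {p : ℝ × ℝ | p.2 ∈ Ioo 0 T} ∈ 𝓝 (x, t) := (isOpen_strip T).mem_nhds ht
  have e1 : fderiv ℝ (fun p : ℝ × ℝ => pdx g p.1 p.2) (x, t) = _ :=
    ((hg.hasFDerivAt_fderiv_apply ht (1, 0)).congr_of_eventuallyEq
      (by filter_upwards [hm] with p hp using hg.pdx_eq hp)).fderiv
  have e2 : fderiv ℝ (fun p : ℝ × ℝ => pdt g p.1 p.2) (x, t) = _ :=
    ((hg.hasFDerivAt_fderiv_apply ht (0, 1)).congr_of_eventuallyEq
      (by filter_upwards [hm] with p hp using hg.pdt_eq hp)).fderiv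
  rw [hg.smoothOnStrip_pdx.pdt_eq ht, hg.smoothOnStrip_pdt.pdx_eq ht, e1, e2]
  exact hs _ _

end SmoothOnStrip

lemma deriv2_nonpos_of_isLocalMax {G G' : ℝ → ℝ} {c : ℝ}
    (hG : ∀ᶠ r in 𝓝 0, HasDerivAt G (G' r) r) (hG' : HasDerivAt G' c 0)
    (hmax : IsLocalMax G 0) : G' 0 = 0 ∧ c ≤ 0 := by
  have h0 : G' 0 = 0 := hmax.hasDerivAt_eq_zero hG.self_of_nhds
  refine ⟨h0, ?_⟩
  by_contra! hc
  have hd : deriv G =ᶠ[𝓝 0] G' := hG.mono fun r hr => hr.deriv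
  have hdd : deriv (deriv G) 0 = c := by rw [hd.deriv_eq, hG'.deriv]
  have hmin : IsLocalMin G 0 := isLocalMin_of_deriv_deriv_pos (by rw [hdd]; exact hc)
    (by rw [hd.self_of_nhds, h0]) hG.self_of_nhds.continuousAt
  have hcst : G =ᶠ[𝓝 0] fun _ => G 0 := by
    filter_upwards [hmax, hmin] with r h1 h2 using le_antisymm h1 h2
  have : deriv (deriv G) 0 = 0 := by
    rw [hcst.deriv.deriv_eq]
    simp
  linarith

lemma deriv_nonpos_of_max_left {g : ℝ → ℝ} {g' a b : ℝ} (hab : a < b) (hg : HasDerivAt g g' a)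
    (hmax : ∀ t ∈ Icc a b, g t ≤ g a) : g' ≤ 0 := by
  have h := hg.tendsto_slope.mono_left (nhdsWithin_mono a (s := Ioi a) fun t ht => ne_of_gt ht)
  refine le_of_tendsto h ?_
  filter_upwards [Ioc_mem_nhdsGT hab] with t ht
  rw [slope_def_field]
  exact div_nonpos_of_nonpos_of_nonneg (by linarith [hmax t ⟨ht.1.le, ht.2⟩]) (by linarith [ht.1])

lemma deriv_nonneg_of_max_right {g : ℝ → ℝ} {g' a b : ℝ} (hab : a < b) (hg : HasDerivAt g g' b)
    (hmax : ∀ t ∈ Icc a b, g t ≤ g b) : 0 ≤ g' := by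
  have h := hg.tendsto_slope.mono_left (nhdsWithin_mono b (s := Iio b) fun t ht => ne_of_lt ht)
  refine ge_of_tendsto h ?_
  filter_upwards [Ico_mem_nhdsLT hab] with t ht
  rw [slope_def_field]
  exact div_nonneg_of_nonpos (by linarith [hmax t ⟨ht.1, ht.2.le⟩]) (by linarith [ht.2])

lemma exists_max_of_periodic {g : ℝ → ℝ → ℝ} {R a b : ℝ} (hR : 0 < R) (hab : a ≤ b)
    (hc : ContinuousOn (fun p : ℝ × ℝ => g p.1 p.2) {p : ℝ × ℝ | p.2 ∈ Icc a b})
    (hp : ∀ x t, t ∈ Icc a b → g (x + R) t = g x t) :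
    ∃ x₀, ∃ t₀ ∈ Icc a b, ∀ x, ∀ t ∈ Icc a b, g x t ≤ g x₀ t₀ := by
  obtain ⟨⟨x₀, t₀⟩, h0, hmax⟩ := (isCompact_Icc (a := (0 : ℝ)) (b := R)).prod
    (isCompact_Icc (a := a) (b := b)) |>.exists_isMaxOn
    ⟨(0, a), ⟨le_rfl, hR.le⟩, ⟨le_rfl, hab⟩⟩ (hc.mono fun p hp => hp.2)
  refine ⟨x₀, t₀, h0.2, fun x t ht => ?_⟩
  obtain ⟨y, hy, hxy⟩ := Function.Periodic.exists_mem_Ico₀ (f := fun x => g x t)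
    (fun x => hp x t ht) hR x
  exact hxy.trans_le (hmax (a := (y, t)) ⟨⟨hy.1, hy.2.le⟩, ht⟩)

lemma exists_abs_le_of_periodic {g : ℝ → ℝ → ℝ} {R a b : ℝ} (hR : 0 < R) (hab : a ≤ b)
    (hc : ContinuousOn (fun p : ℝ × ℝ => g p.1 p.2) {p : ℝ × ℝ | p.2 ∈ Icc a b})
    (hp : ∀ x t, t ∈ Icc a b → g (x + R) t = g x t) :
    ∃ B, ∀ x, ∀ t ∈ Icc a b, |g x t| ≤ B := by
  obtain ⟨x₀, t₀, -, h⟩ := exists_max_of_periodic (g := fun x t => |g x t|) hR hab hc.abs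
    fun x t ht => by rw [hp x t ht]
  exact ⟨_, h⟩

lemma isLocalMax_line {z : ℝ → ℝ → ℝ} {a b x₀ t₀ : ℝ} (ht₀ : t₀ ∈ Ioo a b)
    (hmax : ∀ x, ∀ t ∈ Icc a b, z x t ≤ z x₀ t₀) (α β : ℝ) :
    IsLocalMax (fun r => z (x₀ + α * r) (t₀ + β * r)) 0 := by
  have hc : ContinuousAt (fun r : ℝ => t₀ + β * r) 0 := by fun_prop
  filter_upwards [hc.eventually_mem (s := Icc a b) (by simpa using Icc_mem_nhds ht₀.1 ht₀.2)]
    with r hr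
  simpa using hmax _ _ hr

lemma pdx_periodic {g : ℝ → ℝ → ℝ} {R : ℝ} {s : Set ℝ}
    (hp : ∀ x t, t ∈ s → g (x + R) t = g x t) :
    ∀ x t, t ∈ s → pdx g (x + R) t = pdx g x t := by
  intro x t ht
  have h : (fun y => g (y + R) t) = fun y => g y t := funext fun y => hp y t ht
  have := deriv_comp_add_const (f := fun y => g y t) R x
  rw [pdx, ← this, pdx, h]

/-- A space-periodic classical solution of the MFG system on the open strip `ℝ × (0, T)`. -/
structure IsStripSolution (R T : ℝ) (f : ℝ → ℝ) (u m : ℝ → ℝ → ℝ) : Prop where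
  contDiff_f : ContDiffOn ℝ 2 f (Ioi 0)
  deriv_f_pos : ∀ s ∈ Ioi (0 : ℝ), 0 < deriv f s
  smooth_u : SmoothOnStrip T u
  smooth_m : SmoothOnStrip T m
  periodic_u : ∀ x t : ℝ, t ∈ Ioo 0 T → u (x + R) t = u x t
  periodic_m : ∀ x t : ℝ, t ∈ Ioo 0 T → m (x + R) t = m x t
  m_pos : ∀ x t : ℝ, t ∈ Ioo 0 T → 0 < m x t
  hamilton_jacobi : ∀ x t : ℝ, t ∈ Ioo 0 T → -pdt u x t + (1/2) * (pdx u x t)^2 = f (m x t)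
  continuity : ∀ x t : ℝ, t ∈ Ioo 0 T → pdt m x t - pdx (fun y s => m y s * pdx u y s) x t = 0

lemma hasDerivAt_of_contDiffOn_two {f : ℝ → ℝ} (hf : ContDiffOn ℝ 2 f (Ioi 0)) {s : ℝ}
    (hs : 0 < s) : HasDerivAt f (deriv f s) s :=
  ((hf.contDiffAt (Ioi_mem_nhds hs)).differentiableAt (by simp)).hasDerivAt

lemma contDiffOn_deriv_of_two {f : ℝ → ℝ} (hf : ContDiffOn ℝ 2 f (Ioi 0)) :
    ContDiffOn ℝ 1 (deriv f) (Ioi 0) :=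
  ((contDiffOn_succ_iff_deriv_of_isOpen (n := 1) isOpen_Ioi).1 (by rw [one_add_one_eq_two]; exact hf)).2.2

lemma hasDerivAt_deriv_of_contDiffOn_two {f : ℝ → ℝ} (hf : ContDiffOn ℝ 2 f (Ioi 0)) {s : ℝ}
    (hs : 0 < s) : HasDerivAt (deriv f) (deriv (deriv f) s) s :=
  (((contDiffOn_deriv_of_two hf).contDiffAt (Ioi_mem_nhds hs)).differentiableAt
    (by simp)).hasDerivAt

namespace SmoothOnStrip

variable {T : ℝ} {g : ℝ → ℝ → ℝ}

lemma hasDerivAt_line_deriv (hg : SmoothOnStrip T g) (x t α β : ℝ) (ht : t ∈ Ioo 0 T) :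
    HasDerivAt (fun r => α * pdx g (x + α * r) (t + β * r) + β * pdt g (x + α * r) (t + β * r))
      (α * (α * pdx (pdx g) x t + β * pdt (pdx g) x t)
        + β * (α * pdx (pdt g) x t + β * pdt (pdt g) x t)) 0 := by
  have h1 := hg.smoothOnStrip_pdx.hasDerivAt_line x t α β (r := 0) (by simpa using ht)
  have h2 := hg.smoothOnStrip_pdt.hasDerivAt_line x t α β (r := 0) (by simpa using ht)
  exact ((h1.const_mul α).add (h2.const_mul β)).congr_deriv (by simp)

lemma eventually_hasDerivAt_line (hg : SmoothOnStrip T g) (x t α β : ℝ) (ht : t ∈ Ioo 0 T) :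
    ∀ᶠ r in 𝓝 (0 : ℝ), HasDerivAt (fun r => g (x + α * r) (t + β * r))
      (α * pdx g (x + α * r) (t + β * r) + β * pdt g (x + α * r) (t + β * r)) r := by
  have hc : ContinuousAt (fun r : ℝ => t + β * r) 0 := by fun_prop
  filter_upwards [hc.eventually_mem (s := Ioo 0 T) (by simpa using isOpen_Ioo.mem_nhds ht)]
    with r hr using hg.hasDerivAt_line x t α β hr

lemma continuousOn_slab (hg : SmoothOnStrip T g) {a b : ℝ} (ha : 0 < a) (hb : b < T) :
    ContinuousOn (fun p : ℝ × ℝ => g p.1 p.2) {p : ℝ × ℝ | p.2 ∈ Icc a b} :=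
  (ContDiffOn.continuousOn hg).mono fun _ hp => ⟨ha.trans_le hp.1, hp.2.trans_lt hb⟩

end SmoothOnStrip

namespace IsStripSolution

variable {R T : ℝ} {f : ℝ → ℝ} {u m : ℝ → ℝ → ℝ}

lemma hamilton_jacobi_x (h : IsStripSolution R T f u m) {x t : ℝ} (ht : t ∈ Ioo 0 T) :
    deriv f (m x t) * pdx m x t = -pdt (pdx u) x t + pdx u x t * pdx (pdx u) x t := by
  have h1 := (hasDerivAt_of_contDiffOn_two h.contDiff_f (h.m_pos x t ht)).comp x
    (h.smooth_m.hasDerivAt_fst ht)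
  have h2 := (h.smooth_u.smoothOnStrip_pdt.hasDerivAt_fst (x := x) ht).neg.add
    (((h.smooth_u.smoothOnStrip_pdx.hasDerivAt_fst (x := x) ht).pow 2).const_mul (1/2))
  have e := (h2.congr_of_eventuallyEq (f₁ := f ∘ fun y => m y t)
    (Eventually.of_forall fun y => (h.hamilton_jacobi y t ht).symm)).unique h1
  rw [h.smooth_u.pdx_pdt_comm ht]
  rw [← e]
  simp
  ring

lemma hamilton_jacobi_t (h : IsStripSolution R T f u m) {x t : ℝ} (ht : t ∈ Ioo 0 T) :
    deriv f (m x t) * pdt m x t = -pdt (pdt u) x t + pdx u x t * pdt (pdx u) x t := by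
  have h1 := (hasDerivAt_of_contDiffOn_two h.contDiff_f (h.m_pos x t ht)).comp t
    (h.smooth_m.hasDerivAt_snd ht)
  have h2 := (h.smooth_u.smoothOnStrip_pdt.hasDerivAt_snd (x := x) ht).neg.add
    (((h.smooth_u.smoothOnStrip_pdx.hasDerivAt_snd (x := x) ht).pow 2).const_mul (1/2))
  have e := (h2.congr_of_eventuallyEq (f₁ := f ∘ fun s => m x s)
    (by filter_upwards [isOpen_Ioo.mem_nhds ht] with s hs
          using (h.hamilton_jacobi x s hs).symm)).unique h1
  rw [← e]
  simp
  ring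

lemma pdt_m_eq (h : IsStripSolution R T f u m) {x t : ℝ} (ht : t ∈ Ioo 0 T) :
    pdt m x t = pdx m x t * pdx u x t + m x t * pdx (pdx u) x t := by
  have h1 := (h.smooth_m.hasDerivAt_fst (x := x) ht).mul
    (h.smooth_u.smoothOnStrip_pdx.hasDerivAt_fst (x := x) ht)
  have h2 : pdx (fun y s => m y s * pdx u y s) x t = _ := h1.deriv
  linarith [h.continuity x t ht]

lemma pdt_pdt_m_eq (h : IsStripSolution R T f u m) {x t : ℝ} (ht : t ∈ Ioo 0 T) :
    pdt (pdt m) x t = pdt (pdx m) x t * pdx u x t + pdx m x t * pdt (pdx u) x t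
      + (pdt m x t * pdx (pdx u) x t + m x t * pdt (pdx (pdx u)) x t) := by
  have h1 := ((h.smooth_m.smoothOnStrip_pdx.hasDerivAt_snd (x := x) ht).mul
    (h.smooth_u.smoothOnStrip_pdx.hasDerivAt_snd (x := x) ht)).add
    ((h.smooth_m.hasDerivAt_snd (x := x) ht).mul
      (h.smooth_u.smoothOnStrip_pdx.smoothOnStrip_pdx.hasDerivAt_snd (x := x) ht))
  exact (h1.congr_of_eventuallyEq (f₁ := fun s => pdt m x s)
    (by filter_upwards [isOpen_Ioo.mem_nhds ht] with s hs using h.pdt_m_eq hs)).deriv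

lemma pdx_pdt_m_eq (h : IsStripSolution R T f u m) {x t : ℝ} (ht : t ∈ Ioo 0 T) :
    pdx (pdt m) x t = pdx (pdx m) x t * pdx u x t + pdx m x t * pdx (pdx u) x t
      + (pdx m x t * pdx (pdx u) x t + m x t * pdx (pdx (pdx u)) x t) := by
  have h1 := ((h.smooth_m.smoothOnStrip_pdx.hasDerivAt_fst (x := x) ht).mul
    (h.smooth_u.smoothOnStrip_pdx.hasDerivAt_fst (x := x) ht)).add
    ((h.smooth_m.hasDerivAt_fst (x := x) ht).mul
      (h.smooth_u.smoothOnStrip_pdx.smoothOnStrip_pdx.hasDerivAt_fst (x := x) ht))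
  exact (h1.congr_of_eventuallyEq (f₁ := fun y => pdt m y t)
    (Eventually.of_forall fun y => h.pdt_m_eq ht)).deriv

lemma hasDerivAt_deriv_f_comp (h : IsStripSolution R T f u m) {x t : ℝ} (ht : t ∈ Ioo 0 T) :
    HasDerivAt (fun y => deriv f (m y t)) (deriv (deriv f) (m x t) * pdx m x t) x :=
  (hasDerivAt_deriv_of_contDiffOn_two h.contDiff_f (h.m_pos x t ht)).comp (h := fun y => m y t) x
    (h.smooth_m.hasDerivAt_fst ht)

lemma hamilton_jacobi_xx (h : IsStripSolution R T f u m) {x t : ℝ} (ht : t ∈ Ioo 0 T) :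
    deriv (deriv f) (m x t) * pdx m x t * pdx m x t + deriv f (m x t) * pdx (pdx m) x t
      = -pdx (pdt (pdx u)) x t + (pdx (pdx u) x t * pdx (pdx u) x t
        + pdx u x t * pdx (pdx (pdx u)) x t) := by
  have h1 := (h.hasDerivAt_deriv_f_comp ht).mul
    (h.smooth_m.smoothOnStrip_pdx.hasDerivAt_fst (x := x) ht)
  have h2 := (h.smooth_u.smoothOnStrip_pdx.smoothOnStrip_pdt.hasDerivAt_fst (x := x) ht).neg.add
    ((h.smooth_u.smoothOnStrip_pdx.hasDerivAt_fst (x := x) ht).mul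
    (h.smooth_u.smoothOnStrip_pdx.smoothOnStrip_pdx.hasDerivAt_fst (x := x) ht))
  exact h1.unique (h2.congr_of_eventuallyEq
    (Eventually.of_forall fun y => h.hamilton_jacobi_x ht))

/-- The quasilinear elliptic equation satisfied by the value function. -/
lemma elliptic (h : IsStripSolution R T f u m) {x t : ℝ} (ht : t ∈ Ioo 0 T) :
    pdt (pdt u) x t - 2 * (pdx u x t * pdt (pdx u) x t)
      + (pdx u x t * pdx u x t + m x t * deriv f (m x t)) * pdx (pdx u) x t = 0 := by
  linear_combination h.hamilton_jacobi_t ht - deriv f (m x t) * h.pdt_m_eq ht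
    - pdx u x t * h.hamilton_jacobi_x ht

lemma pdx_pdt_pdt (h : IsStripSolution R T f u m) {x t : ℝ} (ht : t ∈ Ioo 0 T) :
    pdx (pdt (pdt u)) x t = pdt (pdt (pdx u)) x t := by
  rw [← h.smooth_u.smoothOnStrip_pdt.pdx_pdt_comm ht]
  refine EventuallyEq.deriv_eq ?_
  filter_upwards [isOpen_Ioo.mem_nhds ht] with s hs using (h.smooth_u.pdx_pdt_comm hs).symm

lemma elliptic_x (h : IsStripSolution R T f u m) {x t : ℝ} (ht : t ∈ Ioo 0 T) :
    pdt (pdt (pdx u)) x t - 2 * (pdx (pdx u) x t * pdt (pdx u) x t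
        + pdx u x t * pdx (pdt (pdx u)) x t)
      + ((2 * pdx u x t * pdx (pdx u) x t + (pdx m x t * deriv f (m x t)
          + m x t * (deriv (deriv f) (m x t) * pdx m x t))) * pdx (pdx u) x t
        + (pdx u x t * pdx u x t + m x t * deriv f (m x t)) * pdx (pdx (pdx u)) x t) = 0 := by
  have hw := h.smooth_u.smoothOnStrip_pdx.hasDerivAt_fst (x := x) ht
  have hwx := h.smooth_u.smoothOnStrip_pdx.smoothOnStrip_pdx.hasDerivAt_fst (x := x) ht
  have hwt := h.smooth_u.smoothOnStrip_pdx.smoothOnStrip_pdt.hasDerivAt_fst (x := x) ht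
  have hutt := h.smooth_u.smoothOnStrip_pdt.smoothOnStrip_pdt.hasDerivAt_fst (x := x) ht
  have h1 := (hutt.sub ((hw.mul hwt).const_mul 2)).add (((hw.mul hw).add
    ((h.smooth_m.hasDerivAt_fst (x := x) ht).mul (h.hasDerivAt_deriv_f_comp ht))).mul hwx)
  have e := h1.unique ((hasDerivAt_const x (0 : ℝ)).congr_of_eventuallyEq
    (Eventually.of_forall fun y => h.elliptic ht))
  rw [h.pdx_pdt_pdt ht] at e
  simp only [Pi.add_apply, Pi.mul_apply] at e
  linear_combination e

/-- Weak maximum principle for a multiple of the density. -/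
lemma mul_m_le (h : IsStripSolution R T f u m) (hR : 0 < R) {a b : ℝ} (ha : 0 < a) (hab : a < b)
    (hb : b < T) (c B : ℝ) (hBa : ∀ x, c * m x a ≤ B) (hBb : ∀ x, c * m x b ≤ B) :
    ∀ x, ∀ t ∈ Icc a b, c * m x t ≤ B := by
  have hsub : ∀ {t}, t ∈ Icc a b → t ∈ Ioo 0 T := fun ht =>
    ⟨ha.trans_le ht.1, ht.2.trans_lt hb⟩
  obtain ⟨N, hN⟩ := exists_abs_le_of_periodic hR hab.le
    (h.smooth_u.smoothOnStrip_pdx.smoothOnStrip_pdx.continuousOn_slab ha hb)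
    (fun x t ht => pdx_periodic (pdx_periodic h.periodic_u) x t (hsub ht))
  have hN0 : 0 ≤ N := (abs_nonneg _).trans (hN 0 a ⟨le_rfl, hab.le⟩)
  set l : ℝ := 2 * N + 1 with hl
  intro x t ht
  refine le_of_forall_pos_le_add fun ε hε => ?_
  have hexp : ∀ t ∈ Icc a b, ε * Real.exp (l * (t - b)) ≤ ε := fun t ht => by
    have : Real.exp (l * (t - b)) ≤ 1 := Real.exp_le_one_iff.2
      (mul_nonpos_of_nonneg_of_nonpos (by positivity) (by linarith [ht.2]))
    nlinarith
  obtain ⟨x₀, t₀, ht₀, hmax⟩ := exists_max_of_periodic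
    (g := fun x t => c * m x t + ε * Real.exp (l * (t - b))) hR hab.le
    (((h.smooth_m.continuousOn_slab ha hb).const_smul c).add (by fun_prop))
    (fun x t ht => by rw [h.periodic_m x t (hsub ht)])
  have key : c * m x₀ t₀ ≤ B := by
    by_cases hta : t₀ = a
    · rw [hta]; exact hBa x₀
    by_cases htb : t₀ = b
    · rw [htb]; exact hBb x₀
    exfalso
    have ht₁ : t₀ ∈ Ioo a b := ⟨lt_of_le_of_ne ht₀.1 (Ne.symm hta), lt_of_le_of_ne ht₀.2 htb⟩
    have hts := hsub ht₀
    have test : ∀ α β : ℝ,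
        c * (α * pdx m x₀ t₀ + β * pdt m x₀ t₀) + ε * (Real.exp (l * (t₀ - b)) * (l * β)) = 0 ∧
        c * (α * (α * pdx (pdx m) x₀ t₀ + β * pdt (pdx m) x₀ t₀)
          + β * (α * pdx (pdt m) x₀ t₀ + β * pdt (pdt m) x₀ t₀))
          + ε * ((Real.exp (l * (t₀ - b)) * (l * β)) * (l * β)) ≤ 0 := by
      intro α β
      have hE : ∀ r : ℝ, HasDerivAt (fun r => Real.exp (l * (t₀ + β * r - b)))
          (Real.exp (l * (t₀ + β * r - b)) * (l * β)) r := fun r => by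
        have := ((((((hasDerivAt_id r).const_mul β).const_add t₀).sub_const b).const_mul l)).exp
        simpa using this
      have hE0 := ((hE 0).mul_const (l * β)).const_mul ε
      have h2 := ((h.smooth_m.hasDerivAt_line_deriv x₀ t₀ α β hts).const_mul c).add hE0
      have := deriv2_nonpos_of_isLocalMax
        (G' := fun r => c * (α * pdx m (x₀ + α * r) (t₀ + β * r)
            + β * pdt m (x₀ + α * r) (t₀ + β * r))
          + ε * (Real.exp (l * (t₀ + β * r - b)) * (l * β)))
        (by filter_upwards [h.smooth_m.eventually_hasDerivAt_line x₀ t₀ α β hts] with r hr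
              using (hr.const_mul c).add ((hE r).const_mul ε))
        h2 (isLocalMax_line ht₁ hmax α β)
      simpa using this
    obtain ⟨hx, hxx⟩ := test 1 0
    obtain ⟨hd, hdd⟩ := test (-pdx u x₀ t₀) 1
    have hE : 0 < ε * (Real.exp (l * (t₀ - b)) * l) := by positivity
    set E := ε * (Real.exp (l * (t₀ - b)) * l)
    have hx' : c * pdx m x₀ t₀ = 0 := by linarith
    have hσ : 0 < m x₀ t₀ * deriv f (m x₀ t₀) :=
      mul_pos (h.m_pos _ _ hts) (h.deriv_f_pos _ (h.m_pos _ _ hts))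
    have hxx' : m x₀ t₀ * deriv f (m x₀ t₀) * (c * pdx (pdx m) x₀ t₀) ≤ 0 :=
      mul_nonpos_of_nonneg_of_nonpos hσ.le (by linarith)
    have hct : c * pdt m x₀ t₀ = -E := by
      linear_combination hd + pdx u x₀ t₀ * hx'
    have ident : c * (-pdx u x₀ t₀ * (-pdx u x₀ t₀ * pdx (pdx m) x₀ t₀ + 1 * pdt (pdx m) x₀ t₀)
          + 1 * (-pdx u x₀ t₀ * pdx (pdt m) x₀ t₀ + 1 * pdt (pdt m) x₀ t₀))
        + m x₀ t₀ * deriv f (m x₀ t₀) * (c * pdx (pdx m) x₀ t₀)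
        = -2 * E * pdx (pdx u) x₀ t₀ := by
      linear_combination c * h.pdt_pdt_m_eq hts - c * pdx u x₀ t₀ * h.pdx_pdt_m_eq hts
        + c * m x₀ t₀ * h.hamilton_jacobi_xx hts
        + c * m x₀ t₀ * h.smooth_u.smoothOnStrip_pdx.pdx_pdt_comm hts
        - c * pdx (pdx u) x₀ t₀ * h.pdt_m_eq hts
        + (pdt (pdx u) x₀ t₀ - 3 * pdx u x₀ t₀ * pdx (pdx u) x₀ t₀
          - m x₀ t₀ * deriv (deriv f) (m x₀ t₀) * pdx m x₀ t₀) * hx'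
        + 2 * pdx (pdx u) x₀ t₀ * hct
    have hfin : E * (l - 2 * pdx (pdx u) x₀ t₀) ≤ 0 := by
      simp only [E] at ident ⊢
      linarith
    have := (abs_le.1 (hN x₀ t₀ ht₀)).2
    nlinarith
  have h1 := hmax x t ht
  have h2 := hexp t₀ ht₀
  have h3 : 0 < ε * Real.exp (l * (t - b)) := by positivity
  linarith

lemma u_le_of_left (h : IsStripSolution R T f u m) (hR : 0 < R) {a b N N' : ℝ} (ha : 0 < a)
    (hab : a < b) (hb : b < T) (hNN' : N < N') (hf : ∀ x, ∀ t ∈ Icc a b, |f (m x t)| ≤ N)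
    {B : ℝ} (hB : ∀ x, u x a ≤ B) : ∀ x, ∀ t ∈ Icc a b, u x t ≤ B + N' * (t - a) := by
  have hsub : ∀ {t}, t ∈ Icc a b → t ∈ Ioo 0 T := fun ht =>
    ⟨ha.trans_le ht.1, ht.2.trans_lt hb⟩
  obtain ⟨x₀, t₀, ht₀, hmax⟩ := exists_max_of_periodic
    (g := fun x t => u x t - N' * t) hR hab.le
    ((h.smooth_u.continuousOn_slab ha hb).sub (by fun_prop))
    (fun x t ht => by rw [h.periodic_u x t (hsub ht)])
  intro x t ht
  have h1 := hmax x t ht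
  rcases eq_or_lt_of_le ht₀.1 with rfl | hlt
  · linarith [hB x₀]
  exfalso
  have hx : pdx u x₀ t₀ = 0 := IsLocalMax.hasDerivAt_eq_zero (f := fun y => u y t₀) (a := x₀)
    (Eventually.of_forall fun y => by simpa using hmax y t₀ ht₀)
    (h.smooth_u.hasDerivAt_fst (hsub ht₀))
  have hd := deriv_nonneg_of_max_right hlt
    ((h.smooth_u.hasDerivAt_snd (x := x₀) (hsub ht₀)).sub ((hasDerivAt_id t₀).const_mul N'))
    (fun t ht => hmax x₀ t ⟨ht.1, ht.2.trans ht₀.2⟩)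
  have hj := h.hamilton_jacobi x₀ t₀ (hsub ht₀)
  rw [hx] at hj
  linarith [(abs_le.1 (hf x₀ t₀ ht₀)).1]

lemma le_u_of_right (h : IsStripSolution R T f u m) (hR : 0 < R) {a b N N' : ℝ} (ha : 0 < a)
    (hab : a < b) (hb : b < T) (hNN' : N < N') (hf : ∀ x, ∀ t ∈ Icc a b, |f (m x t)| ≤ N)
    {B : ℝ} (hB : ∀ x, B ≤ u x b) : ∀ x, ∀ t ∈ Icc a b, B - N' * (b - t) ≤ u x t := by
  have hsub : ∀ {t}, t ∈ Icc a b → t ∈ Ioo 0 T := fun ht =>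
    ⟨ha.trans_le ht.1, ht.2.trans_lt hb⟩
  obtain ⟨x₀, t₀, ht₀, hmax⟩ := exists_max_of_periodic
    (g := fun x t => N' * t - u x t) hR hab.le
    (ContinuousOn.sub (by fun_prop) (h.smooth_u.continuousOn_slab ha hb))
    (fun x t ht => by rw [h.periodic_u x t (hsub ht)])
  intro x t ht
  have h1 := hmax x t ht
  rcases eq_or_lt_of_le ht₀.2 with rfl | hlt
  · linarith [hB x₀]
  exfalso
  have hx : pdx u x₀ t₀ = 0 := IsLocalMin.hasDerivAt_eq_zero (f := fun y => u y t₀) (a := x₀)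
    (Eventually.of_forall fun y => by linarith [hmax y t₀ ht₀])
    (h.smooth_u.hasDerivAt_fst (hsub ht₀))
  have hd := deriv_nonpos_of_max_left hlt
    (((hasDerivAt_id t₀).const_mul N').sub (h.smooth_u.hasDerivAt_snd (x := x₀) (hsub ht₀)))
    (fun t ht => hmax x₀ t ⟨ht₀.1.trans ht.1, ht.2⟩)
  have hj := h.hamilton_jacobi x₀ t₀ (hsub ht₀)
  rw [hx] at hj
  linarith [(abs_le.1 (hf x₀ t₀ ht₀)).1]

/-- One-sided Hopf–Lax bound along straight lines. -/
lemma hopf_lax_le (h : IsStripSolution R T f u m) {a b N : ℝ} (ha : 0 < a) (hab : a < b)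
    (hb : b < T) (hf : ∀ x, ∀ t ∈ Icc a b, |f (m x t)| ≤ N) (x y : ℝ) :
    u x a ≤ u y b + (y - x) ^ 2 / (2 * (b - a)) + N * (b - a) := by
  have hL : 0 < b - a := by linarith
  set v := (y - x) / (b - a) with hv
  have hvL : v * (b - a) = y - x := by rw [hv]; field_simp
  have hder : ∀ r ∈ Icc 0 (b - a), HasDerivAt (fun r => u (x + v * r) (a + 1 * r))
      (v * pdx u (x + v * r) (a + 1 * r) + 1 * pdt u (x + v * r) (a + 1 * r)) r := fun r hr =>
    h.smooth_u.hasDerivAt_line x a v 1 ⟨by linarith [hr.1], by linarith [hr.2]⟩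
  have hmv := Convex.mul_sub_le_image_sub_of_le_deriv (convex_Icc 0 (b - a))
    (f := fun r => u (x + v * r) (a + 1 * r)) (C := -(v ^ 2 / 2 + N))
    (fun r hr => (hder r hr).continuousAt.continuousWithinAt)
    (fun r hr => (hder r (interior_subset hr)).differentiableAt.differentiableWithinAt)
    (fun r hr => by
      have hr' := interior_subset hr
      rw [(hder r hr').deriv]
      have ht : a + 1 * r ∈ Icc a b := ⟨by linarith [hr'.1], by linarith [hr'.2]⟩
      have hj := h.hamilton_jacobi (x + v * r) (a + 1 * r)
        ⟨ha.trans_le ht.1, ht.2.trans_lt hb⟩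
      have := (abs_le.1 (hf (x + v * r) _ ht)).2
      nlinarith [sq_nonneg (pdx u (x + v * r) (a + 1 * r) + v)])
    0 ⟨le_rfl, hL.le⟩ (b - a) ⟨hL.le, le_rfl⟩ hL.le
  simp only [mul_zero, add_zero, sub_zero, hvL, one_mul] at hmv
  rw [show x + (y - x) = y by ring, show a + (b - a) = b by ring] at hmv
  have e : (y - x) ^ 2 / (2 * (b - a)) = v ^ 2 / 2 * (b - a) := by
    rw [hv]; field_simp
  rw [e]
  linarith

/-- Oscillation bound for the value function. -/
lemma exists_abs_sub_le (h : IsStripSolution R T f u m) (hR : 0 < R) {a b N N' : ℝ} (ha : 0 < a)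
    (hab : a < b) (hb : b < T) (hL : T / 2 ≤ b - a) (hN : 0 ≤ N) (hNN' : N < N')
    (hf : ∀ x, ∀ t ∈ Icc a b, |f (m x t)| ≤ N) :
    ∃ c, ∀ x, ∀ t ∈ Icc a b, |u x t - c| ≤ R ^ 2 / T + 2 * N' * T := by
  have hT : 0 < T := by linarith
  have hsub : ∀ {t}, t ∈ Icc a b → t ∈ Ioo 0 T := fun ht =>
    ⟨ha.trans_le ht.1, ht.2.trans_lt hb⟩
  have haa : ∀ {t}, t ∈ Icc a a → t ∈ Icc a b := fun ht => ⟨ht.1, ht.2.trans hab.le⟩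
  obtain ⟨x₀, t₀, ht₀, hmax⟩ := exists_max_of_periodic (g := u) hR (le_refl a)
    ((h.smooth_u.continuousOn_slab ha hb).mono fun p hp => haa hp)
    (fun x t ht => h.periodic_u x t (hsub (haa ht)))
  obtain rfl : t₀ = a := le_antisymm ht₀.2 ht₀.1
  refine ⟨u x₀ t₀, fun x t ht => ?_⟩
  have hup := h.u_le_of_left hR ha hab hb hNN' hf (fun x => hmax x t₀ ht₀) x t ht
  have hlow := h.le_u_of_right hR ha hab hb hNN' hf
    (B := u x₀ t₀ - (R ^ 2 / T + N' * T)) (fun y => by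
      obtain ⟨z, hz, hyz⟩ := Function.Periodic.exists_mem_Ico (f := fun x => u x b)
        (fun x => h.periodic_u x b (hsub ⟨hab.le, le_rfl⟩)) hR y x₀
      have h1 := h.hopf_lax_le ha hab hb hf x₀ z
      have h2 : (z - x₀) ^ 2 / (2 * (b - t₀)) ≤ R ^ 2 / T := by
        apply div_le_div₀ (by positivity) _ hT (by linarith)
        nlinarith [hz.1, hz.2]
      have h3 : N * (b - t₀) ≤ N' * T := by
        apply mul_le_mul hNN'.le (by linarith) (by linarith) (by linarith)
      linarith) x t ht
  have hR2 : 0 ≤ R ^ 2 / T := by positivity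
  have h4 : N' * (t - t₀) ≤ N' * T :=
    mul_le_mul_of_nonneg_left (by linarith [ht.2]) (by linarith)
  have h5 : N' * (b - t) ≤ N' * T :=
    mul_le_mul_of_nonneg_left (by linarith [ht.1]) (by linarith)
  have h6 : 0 ≤ N' * T := mul_nonneg (by linarith) hT.le
  rw [abs_le]
  constructor <;> linarith

/-- At a maximum point of `s * ∂ₓu + (u + ℓ)² / 2`, where `ℓ` is affine in time and takes
opposite signs at the two ends of the slab, the quantity `s * ∂ₓu` is bounded. -/
lemma sign_mul_pdx_le (h : IsStripSolution R T f u m) (hR : 0 < R) {a b N K A V κ : ℝ}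
    (ha : 0 < a) (hab : a < b) (hb : b < T) (hN : 0 ≤ N) (hA : 0 ≤ A) (hκ : 0 ≤ κ)
    (hf : ∀ x, ∀ t ∈ Icc a b, |f (m x t)| ≤ N)
    (hfx : ∀ x, ∀ t, t = a ∨ t = b → |deriv f (m x t) * pdx m x t| ≤ N)
    (hf2 : ∀ x, ∀ t ∈ Icc a b, m x t * |deriv (deriv f) (m x t)| ≤ κ * deriv f (m x t))
    {c : ℝ} (hu : ∀ x, ∀ t ∈ Icc a b, |u x t - c| ≤ K) (hKA : K + 1 ≤ A * ((b - a) / 2))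
    (hV : K + A * ((b - a) / 2) ≤ V) {s : ℝ} (hs : s * s = 1) (x t : ℝ) (ht : t ∈ Icc a b) :
    s * pdx u x t ≤ (2 * (3 + κ) * V ^ 2 + 4 * N + 2 * A + 2) + V ^ 2 / 2 := by
  have hsub : ∀ {t}, t ∈ Icc a b → t ∈ Ioo 0 T := fun ht =>
    ⟨ha.trans_le ht.1, ht.2.trans_lt hb⟩
  have hw := h.smooth_u.smoothOnStrip_pdx
  set d : ℝ := A * ((a + b) / 2) + c with hd
  have hcont := h.smooth_u.continuousOn_slab ha hb
  obtain ⟨x₀, t₀, ht₀, hmax⟩ := exists_max_of_periodic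
    (g := fun x t => s * pdx u x t + (u x t + A * t - d) ^ 2 / 2) hR hab.le
    (((hw.continuousOn_slab ha hb).const_smul s).add
      ((((hcont.add (by fun_prop)).sub continuousOn_const).pow 2).div_const 2))
    (fun x t ht => by
      rw [h.periodic_u x t (hsub ht), pdx_periodic h.periodic_u x t (hsub ht)])
  have hts := hsub ht₀
  set Y := 2 * (3 + κ) * V ^ 2 + 4 * N + 2 * A + 2 with hY
  set v := u x₀ t₀ + A * t₀ - d with hv
  have hK : 0 ≤ K := (abs_nonneg _).trans (hu x₀ t₀ ht₀)
  have hvV : v ^ 2 ≤ V ^ 2 := by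
    have h1 := abs_le.1 (hu x₀ t₀ ht₀)
    have h2 : A * t₀ ≤ A * b := mul_le_mul_of_nonneg_left ht₀.2 hA
    have h3 : A * a ≤ A * t₀ := mul_le_mul_of_nonneg_left ht₀.1 hA
    apply sq_le_sq'
    · simp only [hv, hd]; linarith
    · simp only [hv, hd]; linarith
  have hdx : ∀ t, t ∈ Ioo 0 T → ∀ x, HasDerivAt
      (fun y => s * pdx u y t + (u y t + A * t - d) ^ 2 / 2)
      (s * pdx (pdx u) x t + (u x t + A * t - d) * pdx u x t) x := fun t ht x => by
    have := ((hw.hasDerivAt_fst (x := x) ht).const_mul s).add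
      (((((h.smooth_u.hasDerivAt_fst (x := x) ht).add_const (A * t)).sub_const d).pow 2).div_const 2)
    exact this.congr_deriv (by simp; ring)
  have hdt : HasDerivAt (fun t => s * pdx u x₀ t + (u x₀ t + A * t - d) ^ 2 / 2)
      (s * pdt (pdx u) x₀ t₀ + v * (pdt u x₀ t₀ + A)) t₀ := by
    have := ((hw.hasDerivAt_snd (x := x₀) hts).const_mul s).add
      (((((h.smooth_u.hasDerivAt_snd (x := x₀) hts).add
        ((hasDerivAt_id t₀).const_mul A)).sub_const d).pow 2).div_const 2)
    exact this.congr_deriv (by simp [hv]; ring)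
  have hx : s * pdx (pdx u) x₀ t₀ + v * pdx u x₀ t₀ = 0 :=
    IsLocalMax.hasDerivAt_eq_zero (Eventually.of_forall fun y => hmax y t₀ ht₀) (hdx t₀ hts x₀)
  have hj := h.hamilton_jacobi x₀ t₀ hts
  have hjx := h.hamilton_jacobi_x (x := x₀) hts
  have hfb := abs_le.1 (hf x₀ t₀ ht₀)
  have hs' : s = 1 ∨ s = -1 := mul_self_eq_one_iff.1 hs
  have key : s * pdx u x₀ t₀ ≤ Y := by
    by_contra! hyY
    set y := s * pdx u x₀ t₀ with hy
    have hyw : pdx u x₀ t₀ ^ 2 = y ^ 2 := by rw [hy]; linear_combination (-pdx u x₀ t₀ ^ 2) * hs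
    have hV2 : 0 ≤ (3 + κ) * V ^ 2 := by positivity
    have hy1 : 1 ≤ y := by linarith
    -- the material derivative of `u + ℓ` is very negative
    set q := pdt u x₀ t₀ + A - pdx u x₀ t₀ ^ 2 with hq
    have hqb : q ≤ -(y ^ 2 / 2) + N + A := by
      rw [hq]; linarith
    have hyy : (3 + κ) * V ^ 2 * y + N + A + N + 1 ≤ y ^ 2 / 2 := by
      nlinarith
    have hq0 : q ≤ -(N + 1) := by nlinarith
    have hφ : s * pdt (pdx u) x₀ t₀ + v * (pdt u x₀ t₀ + A)
        = v * q - s * (deriv f (m x₀ t₀) * pdx m x₀ t₀) := by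
      rw [hjx, hq]; linear_combination pdx u x₀ t₀ * hx
    have hsN : t₀ = a ∨ t₀ = b → |s * (deriv f (m x₀ t₀) * pdx m x₀ t₀)| ≤ N := fun h0 => by
      rw [abs_mul]
      have : |s| = 1 := by rcases hs' with rfl | rfl <;> simp
      rw [this, one_mul]; exact hfx x₀ t₀ h0
    by_cases hta : t₀ = a
    · have h1 := deriv_nonpos_of_max_left (b := b) (by rwa [hta]) hdt
        (fun t ht => hmax x₀ t ⟨ht₀.1.trans ht.1, ht.2⟩)
      have h2 := (abs_le.1 (hsN (Or.inl hta))).2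
      have h3 : v ≤ -1 := by
        have h4 := (abs_le.1 (hu x₀ t₀ ht₀)).2
        have h5 : A * t₀ = A * a := by rw [hta]
        linarith
      have h6 := mul_nonneg (sub_nonneg.2 h3) (by linarith : 0 ≤ -q)
      linarith
    by_cases htb : t₀ = b
    · have h1 := deriv_nonneg_of_max_right (a := a) (by rwa [htb]) hdt
        (fun t ht => hmax x₀ t ⟨ht.1, ht.2.trans ht₀.2⟩)
      have h2 := (abs_le.1 (hsN (Or.inr htb))).1
      have h3 : 1 ≤ v := by
        have h4 := (abs_le.1 (hu x₀ t₀ ht₀)).1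
        have h5 : A * t₀ = A * b := by rw [htb]
        linarith
      have h6 := mul_nonneg (sub_nonneg.2 h3) (by linarith : 0 ≤ -q)
      linarith
    have ht₁ : t₀ ∈ Ioo a b := ⟨lt_of_le_of_ne ht₀.1 (Ne.symm hta), lt_of_le_of_ne ht₀.2 htb⟩
    have test : ∀ α β : ℝ,
        s * (α * pdx (pdx u) x₀ t₀ + β * pdt (pdx u) x₀ t₀)
          + v * (α * pdx u x₀ t₀ + β * pdt u x₀ t₀ + A * β) = 0 ∧
        s * (α * (α * pdx (pdx (pdx u)) x₀ t₀ + β * pdt (pdx (pdx u)) x₀ t₀)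
            + β * (α * pdx (pdt (pdx u)) x₀ t₀ + β * pdt (pdt (pdx u)) x₀ t₀))
          + ((α * pdx u x₀ t₀ + β * pdt u x₀ t₀ + A * β) ^ 2
            + v * (α * (α * pdx (pdx u) x₀ t₀ + β * pdt (pdx u) x₀ t₀)
              + β * (α * pdx (pdt u) x₀ t₀ + β * pdt (pdt u) x₀ t₀))) ≤ 0 := by
      intro α β
      have hl : ∀ r : ℝ, HasDerivAt (fun r => A * (t₀ + β * r)) (A * β) r := fun r => by
        simpa using ((((hasDerivAt_id r).const_mul β).const_add t₀).const_mul A)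
      have hv0 := (((h.smooth_u.eventually_hasDerivAt_line x₀ t₀ α β hts).self_of_nhds).add
        (hl 0)).sub_const d
      have h2 := ((hw.hasDerivAt_line_deriv x₀ t₀ α β hts).const_mul s).add
        (hv0.mul ((h.smooth_u.hasDerivAt_line_deriv x₀ t₀ α β hts).add_const (A * β)))
      have := deriv2_nonpos_of_isLocalMax
        (G' := fun r => s * (α * pdx (pdx u) (x₀ + α * r) (t₀ + β * r)
            + β * pdt (pdx u) (x₀ + α * r) (t₀ + β * r))
          + (u (x₀ + α * r) (t₀ + β * r) + A * (t₀ + β * r) - d)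
            * (α * pdx u (x₀ + α * r) (t₀ + β * r)
              + β * pdt u (x₀ + α * r) (t₀ + β * r) + A * β))
        (by
          filter_upwards [h.smooth_u.eventually_hasDerivAt_line x₀ t₀ α β hts,
            hw.eventually_hasDerivAt_line x₀ t₀ α β hts] with r hr hr'
          exact ((hr'.const_mul s).add ((((hr.add (hl r)).sub_const d).pow 2).div_const 2)).congr_deriv
            (by simp; ring))
        h2 (isLocalMax_line ht₁ hmax α β)
      simp only [mul_zero, add_zero, Pi.add_apply] at this
      refine ⟨this.1, le_of_eq_of_le ?_ this.2⟩
      rw [hv]; ring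
    obtain ⟨-, hxx⟩ := test 1 0
    obtain ⟨hD, hDD⟩ := test (-pdx u x₀ t₀) 1
    have hσ : 0 < m x₀ t₀ * deriv f (m x₀ t₀) :=
      mul_pos (h.m_pos _ _ hts) (h.deriv_f_pos _ (h.m_pos _ _ hts))
    have hxx' := mul_nonpos_of_nonneg_of_nonpos hσ.le hxx
    have hfp := h.deriv_f_pos _ (h.m_pos x₀ t₀ hts)
    obtain ⟨e, he, heκ⟩ : ∃ e, m x₀ t₀ * deriv (deriv f) (m x₀ t₀) = e * deriv f (m x₀ t₀)
        ∧ |e| ≤ κ := by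
      refine ⟨m x₀ t₀ * deriv (deriv f) (m x₀ t₀) / deriv f (m x₀ t₀), by field_simp, ?_⟩
      rw [abs_div, abs_mul, abs_of_pos hfp, abs_of_pos (h.m_pos x₀ t₀ hts), div_le_iff₀ hfp]
      exact hf2 x₀ t₀ ht₀
    have hsφ : s * (deriv f (m x₀ t₀) * pdx m x₀ t₀) = v * q := by
      rw [hjx, hq]; linear_combination -hD
    have ident : q * (q + (3 + e) * v ^ 2 * y)
        + m x₀ t₀ * deriv f (m x₀ t₀) * pdx u x₀ t₀ ^ 2 ≤ 0 := by
      have hq2 : -pdx u x₀ t₀ * pdx u x₀ t₀ + 1 * pdt u x₀ t₀ + A * 1 = q := by rw [hq]; ring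
      rw [hq2] at hDD
      have hφ2 : (deriv f (m x₀ t₀) * pdx m x₀ t₀) = s * (v * q) := by
        linear_combination s * hsφ - (deriv f (m x₀ t₀) * pdx m x₀ t₀) * hs
      refine le_of_eq_of_le ?_ (add_nonpos hDD hxx')
      linear_combination (-s) * h.elliptic_x hts - v * h.elliptic hts
        + s * pdx u x₀ t₀ * hw.pdx_pdt_comm hts
        - v * pdx u x₀ t₀ * h.smooth_u.pdx_pdt_comm hts
        - 2 * s * pdx (pdx u) x₀ t₀ * hjx + s * pdx (pdx u) x₀ t₀ * pdx m x₀ t₀ * he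
        + (3 + e) * (deriv f (m x₀ t₀) * pdx m x₀ t₀) * hx
        - (3 + e) * v * pdx u x₀ t₀ * hφ2 + (3 + e) * v ^ 2 * q * hy
    have h3e : 0 ≤ 3 + e → (3 + e) * v ^ 2 * y ≤ (3 + κ) * V ^ 2 * y := fun h0 => by
      have := (abs_le.1 heκ).2
      gcongr
    have hneg : q + (3 + e) * v ^ 2 * y < 0 := by
      by_cases h0 : 0 ≤ 3 + e
      · linarith [h3e h0]
      · have : (3 + e) * v ^ 2 * y ≤ 0 :=
          mul_nonpos_of_nonpos_of_nonneg
            (mul_nonpos_of_nonpos_of_nonneg (by linarith) (sq_nonneg v)) (by linarith)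
        linarith
    have hpos : 0 < q * (q + (3 + e) * v ^ 2 * y) := mul_pos_of_neg_of_neg (by linarith) hneg
    have : 0 ≤ m x₀ t₀ * deriv f (m x₀ t₀) * pdx u x₀ t₀ ^ 2 := by positivity
    linarith
  have h1 := hmax x t ht
  have h2 : 0 ≤ (u x t + A * t - d) ^ 2 := sq_nonneg _
  linarith

end IsStripSolution

lemma hasDerivAt_pdx_closed {g : ℝ → ℝ → ℝ} {T : ℝ}
    (hg : ContDiffOn ℝ (⊤ : ℕ∞) (fun p : ℝ × ℝ => g p.1 p.2) {p : ℝ × ℝ | p.2 ∈ Icc 0 T})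
    {x t : ℝ} (ht : t ∈ Icc 0 T) :
    HasDerivAt (fun y => g y t) (fderivWithin ℝ (fun p : ℝ × ℝ => g p.1 p.2)
      {p : ℝ × ℝ | p.2 ∈ Icc 0 T} (x, t) (1, 0)) x := by
  have h := ((hg.differentiableOn (by simp)) (x, t) ht).hasFDerivWithinAt
  have h1 := h.comp_hasDerivWithinAt x (s := univ)
    ((hasDerivAt_id x).prodMk (hasDerivAt_const x t)).hasDerivWithinAt (fun y _ => ht)
  exact hasDerivWithinAt_univ.1 h1

lemma continuousOn_pdx_closed {g : ℝ → ℝ → ℝ} {T : ℝ} (hT : 0 < T)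
    (hg : ContDiffOn ℝ (⊤ : ℕ∞) (fun p : ℝ × ℝ => g p.1 p.2) {p : ℝ × ℝ | p.2 ∈ Icc 0 T}) :
    ContinuousOn (fun p : ℝ × ℝ => pdx g p.1 p.2) {p : ℝ × ℝ | p.2 ∈ Icc 0 T} := by
  have hs : {p : ℝ × ℝ | p.2 ∈ Icc 0 T} = univ ×ˢ Icc 0 T := by ext; simp
  have hu : UniqueDiffOn ℝ {p : ℝ × ℝ | p.2 ∈ Icc 0 T} := by
    rw [hs]; exact uniqueDiffOn_univ.prod (uniqueDiffOn_Icc hT)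
  have h := (hg.continuousOn_fderivWithin hu (by simp)).clm_apply
    (continuousOn_const (c := ((1, 0) : ℝ × ℝ)))
  exact h.congr fun p hp => (hasDerivAt_pdx_closed hg hp).deriv

lemma eventually_forall_lt_of_periodic {q : ℝ → ℝ → ℝ} {R T c t₀ : ℝ} (hR : 0 < R)
    (hq : ContinuousOn (fun p : ℝ × ℝ => q p.1 p.2) {p : ℝ × ℝ | p.2 ∈ Icc 0 T})
    (hp : ∀ x t, t ∈ Icc 0 T → q (x + R) t = q x t) (ht₀ : t₀ ∈ Icc 0 T)
    (hc : ∀ x, q x t₀ < c) : ∀ᶠ t in 𝓝[Icc 0 T] t₀, ∀ x, q x t < c := by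
  have h := (isCompact_Icc (a := (0 : ℝ)) (b := R)).eventually_forall_of_forall_eventually
    (x₀ := t₀) (P := fun t x => t ∈ Icc 0 T → q x t < c) (fun x _ => by
      have h1 : ∀ᶠ p in 𝓝[{p : ℝ × ℝ | p.2 ∈ Icc 0 T}] (x, t₀), q p.1 p.2 < c :=
        (hq (x, t₀) ht₀).eventually_lt_const (hc x)
      rw [eventually_nhdsWithin_iff] at h1
      exact (continuous_swap.tendsto (t₀, x)).eventually h1)
  rw [eventually_nhdsWithin_iff]
  filter_upwards [h] with t ht htT x
  obtain ⟨y, hy, hxy⟩ := Function.Periodic.exists_mem_Ico₀ (f := fun x => q x t)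
    (fun x => hp x t htT) hR x
  exact hxy.trans_lt (ht y ⟨hy.1, hy.2.le⟩ htT)

lemma bddAbove_of_periodic {q : ℝ → ℝ → ℝ} {R T t : ℝ} (hR : 0 < R)
    (hq : ContinuousOn (fun p : ℝ × ℝ => q p.1 p.2) {p : ℝ × ℝ | p.2 ∈ Icc 0 T})
    (hp : ∀ x t, t ∈ Icc 0 T → q (x + R) t = q x t) (ht : t ∈ Icc 0 T) :
    BddAbove (range fun x => q x t) := by
  obtain ⟨B, hB⟩ := exists_abs_le_of_periodic hR (ht.1.trans ht.2) hq hp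
  exact ⟨B, by rintro _ ⟨x, rfl⟩; exact (le_abs_self _).trans (hB x t ht)⟩

/-- A bound for a continuous function on the open strip extends to the closed strip. -/
lemma abs_le_closed_of_abs_le_open {q : ℝ → ℝ → ℝ} {T W : ℝ} (hT : 0 < T)
    (hq : ContinuousOn (fun p : ℝ × ℝ => q p.1 p.2) {p : ℝ × ℝ | p.2 ∈ Icc 0 T})
    (h : ∀ x, ∀ t ∈ Ioo 0 T, |q x t| ≤ W) : ∀ x, ∀ t ∈ Icc 0 T, |q x t| ≤ W := by
  intro x t ht
  have hc : ContinuousOn (fun s => |q x s|) (Icc 0 T) :=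
    (hq.comp (f := fun s => (x, s)) (by fun_prop) fun s hs => hs).abs
  have hcl : t ∈ closure (Ioo 0 T) := by rwa [closure_Ioo hT.ne]
  have := mem_closure_iff_nhdsWithin_neBot.1 hcl
  exact le_of_tendsto ((hc t ht).mono Ioo_subset_Icc_self)
    (eventually_nhdsWithin_of_forall fun s hs => h x s hs)

/-- Interior gradient bound with data controlled on two time slices. -/
lemma IsStripSolution.abs_pdx_le {R T N K A V κ : ℝ} {f : ℝ → ℝ} {u m : ℝ → ℝ → ℝ}
    (h : IsStripSolution R T f u m) (hR : 0 < R) {a b B : ℝ} (ha : 0 < a) (hab : a < b)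
    (hb : b < T) (hL : T / 2 ≤ b - a) (hN : 0 ≤ N) (hκ : 0 ≤ κ)
    (hK : K = R ^ 2 / T + 2 * (N + 1) * T) (hA : A = 4 * (K + 1) / T) (hV : V = K + A * T / 2)
    (hf : ∀ x, ∀ t, t = a ∨ t = b → |f (m x t)| ≤ N)
    (hm : ∀ x, ∀ t, t = a ∨ t = b → m x t ≤ B)
    (hfx : ∀ x, ∀ t, t = a ∨ t = b → |deriv f (m x t) * pdx m x t| ≤ N)
    (hf2 : ∀ s, 0 < s → s ≤ B → s * |deriv (deriv f) s| ≤ κ * deriv f s)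
    (x t : ℝ) (ht : t ∈ Icc a b) :
    |pdx u x t| ≤ (2 * (3 + κ) * V ^ 2 + 4 * N + 2 * A + 2) + V ^ 2 / 2 ∧ |f (m x t)| ≤ N := by
  have hT : 0 < T := by linarith
  have hsub : ∀ {t}, t ∈ Icc a b → t ∈ Ioo 0 T := fun ht =>
    ⟨ha.trans_le ht.1, ht.2.trans_lt hb⟩
  have ha' : a ∈ Icc a b := ⟨le_rfl, hab.le⟩
  have hb' : b ∈ Icc a b := ⟨hab.le, le_rfl⟩
  have hmB : ∀ x, ∀ t ∈ Icc a b, m x t ≤ B := fun x t ht => by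
    simpa using h.mul_m_le hR ha hab hb 1 B (fun x => by simpa using hm x a (Or.inl rfl))
      (fun x => by simpa using hm x b (Or.inr rfl)) x t ht
  have hmono : StrictMonoOn f (Ioi 0) := strictMonoOn_of_deriv_pos (convex_Ioi 0)
    h.contDiff_f.continuousOn (fun s hs => h.deriv_f_pos s (interior_subset hs))
  have hms := h.smooth_m.continuousOn_slab ha hb
  -- the extreme values of `m` on the two slices
  have hslice : ∀ c : ℝ, ∃ x₁, ∃ t₁, (t₁ = a ∨ t₁ = b) ∧
      ∀ x, ∀ t ∈ Icc a b, c * m x t ≤ c * m x₁ t₁ := fun c => by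
    have hmax : ∀ t₁ ∈ Icc a b, ∃ x₁, ∀ x, c * m x t₁ ≤ c * m x₁ t₁ := fun t₁ ht₁ => by
      have hss : ∀ {t}, t ∈ Icc t₁ t₁ → t ∈ Icc a b := fun ht =>
        ⟨ht₁.1.trans ht.1, ht.2.trans ht₁.2⟩
      obtain ⟨x₁, t₂, ht₂, hx₁⟩ := exists_max_of_periodic (g := fun x t => c * m x t) hR
        (le_refl t₁) ((hms.const_smul c).mono fun p hp => hss hp)
        (fun x t ht => by rw [h.periodic_m x t (hsub (hss ht))])
      obtain rfl : t₂ = t₁ := le_antisymm ht₂.2 ht₂.1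
      exact ⟨x₁, fun x => hx₁ x t₂ ht₂⟩
    obtain ⟨xa, hxa⟩ := hmax a ha'
    obtain ⟨xb, hxb⟩ := hmax b hb'
    rcases le_total (c * m xa a) (c * m xb b) with hle | hle
    · exact ⟨xb, b, Or.inr rfl, h.mul_m_le hR ha hab hb c _ (fun x => (hxa x).trans hle) hxb⟩
    · exact ⟨xa, a, Or.inl rfl, h.mul_m_le hR ha hab hb c _ hxa (fun x => (hxb x).trans hle)⟩
  have hfN : ∀ x, ∀ t ∈ Icc a b, |f (m x t)| ≤ N := fun x t ht => by
    have hin : ∀ {t₁}, (t₁ = a ∨ t₁ = b) → t₁ ∈ Ioo 0 T := fun h1 =>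
      hsub (by rcases h1 with rfl | rfl <;> assumption)
    obtain ⟨x₁, t₁, ht₁, h1⟩ := hslice 1
    obtain ⟨x₂, t₂, ht₂, h2⟩ := hslice (-1)
    have hp := h.m_pos x t (hsub ht)
    have e1 : f (m x t) ≤ f (m x₁ t₁) :=
      hmono.monotoneOn hp (h.m_pos _ _ (hin ht₁)) (by linarith [h1 x t ht])
    have e2 : f (m x₂ t₂) ≤ f (m x t) :=
      hmono.monotoneOn (h.m_pos _ _ (hin ht₂)) hp (by linarith [h2 x t ht])
    have e3 := (abs_le.1 (hf x₁ t₁ ht₁)).2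
    have e4 := (abs_le.1 (hf x₂ t₂ ht₂)).1
    exact abs_le.2 ⟨by linarith, by linarith⟩
  obtain ⟨c, hc⟩ := h.exists_abs_sub_le hR ha hab hb hL hN (lt_add_one N) hfN
  rw [← hK] at hc
  have hK0 : 0 ≤ K := (abs_nonneg _).trans (hc x t ht)
  have hA0 : 0 ≤ A := by rw [hA]; positivity
  have hAT : A * T = 4 * (K + 1) := by rw [hA]; field_simp
  have hbound : ∀ s : ℝ, s * s = 1 →
      s * pdx u x t ≤ (2 * (3 + κ) * V ^ 2 + 4 * N + 2 * A + 2) + V ^ 2 / 2 := fun s hs =>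
    h.sign_mul_pdx_le hR ha hab hb hN hA0 hκ hfN hfx
      (fun x t ht => hf2 _ (h.m_pos x t (hsub ht)) (hmB x t ht)) hc (by nlinarith)
      (by rw [hV]; nlinarith) hs x t ht
  have h1 := hbound 1 (by norm_num)
  have h2 := hbound (-1) (by norm_num)
  exact ⟨abs_le.2 ⟨by linarith, by linarith⟩, hfN x t ht⟩

/-- A priori Lipschitz estimate for the planning problem: the gradient of the value
function is bounded by a constant depending only on `κ₀, R, T, 1/T, M`, independently of
the lower bound of `m`. -/
theorem stmt6
    (κ₀ R T M : ℝ) (hκ : 0 < κ₀) (hR : 1 ≤ R) (hT : 0 < T) (hM : 0 < M) :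
    ∃ C : ℝ, 0 < C ∧
      ∀ (f : ℝ → ℝ) (u m : ℝ → ℝ → ℝ),
        ContDiffOn ℝ 2 f (Ioi 0) →
        (∀ s ∈ Ioi (0:ℝ), 0 < deriv f s) →
        ContDiffOn ℝ (⊤ : ℕ∞) (fun p : ℝ × ℝ => u p.1 p.2) {p : ℝ × ℝ | p.2 ∈ Icc 0 T} →
        ContDiffOn ℝ (⊤ : ℕ∞) (fun p : ℝ × ℝ => m p.1 p.2) {p : ℝ × ℝ | p.2 ∈ Icc 0 T} →
        (∀ x t : ℝ, t ∈ Icc 0 T → u (x + R) t = u x t) →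
        (∀ x t : ℝ, t ∈ Icc 0 T → m (x + R) t = m x t) →
        (∀ x t : ℝ, t ∈ Icc 0 T → 0 < m x t) →
        (∀ x t : ℝ, t ∈ Icc 0 T →
          -pdt u x t + (1/2) * (pdx u x t)^2 = f (m x t)) →
        (∀ x t : ℝ, t ∈ Icc 0 T →
          pdt m x t - pdx (fun y s => m y s * pdx u y s) x t = 0) →
        (∀ s : ℝ, 0 < s → s ≤ 2 * max (⨆ x : ℝ, m x 0) (⨆ x : ℝ, m x T) →
          s * deriv f s ≤ κ₀ ∧ s * |deriv (deriv f) s| / deriv f s ≤ κ₀) →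
        ((⨆ x : ℝ, |f (m x 0)|) + (⨆ x : ℝ, |deriv (fun y => f (m y 0)) x|) ≤ M) →
        ((⨆ x : ℝ, |f (m x T)|) + (⨆ x : ℝ, |deriv (fun y => f (m y T)) x|) ≤ M) →
        ∀ x t : ℝ, t ∈ Icc 0 T → |pdx u x t| + |pdt u x t| ≤ C := by
  obtain ⟨K, hK⟩ : ∃ K, K = R ^ 2 / T + 2 * (M + 1 + 1) * T := ⟨_, rfl⟩
  obtain ⟨A, hA⟩ : ∃ A, A = 4 * (K + 1) / T := ⟨_, rfl⟩
  obtain ⟨V, hV⟩ : ∃ V, V = K + A * T / 2 := ⟨_, rfl⟩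
  obtain ⟨W, hW⟩ : ∃ W, W = (2 * (3 + κ₀) * V ^ 2 + 4 * (M + 1) + 2 * A + 2) + V ^ 2 / 2 :=
    ⟨_, rfl⟩
  have hR0 : 0 < R := by linarith
  have hW0 : 0 < W := by
    have hK0 : 0 < K := by rw [hK]; positivity
    have hA0 : 0 < A := by rw [hA]; positivity
    rw [hW]; positivity
  refine ⟨W + W ^ 2 / 2 + (M + 1), by positivity, ?_⟩
  intro f u m hf hf' hu hm hpu hpm hpos hhj hcont hκf hM0 hMT
  have hopen : {p : ℝ × ℝ | p.2 ∈ Ioo 0 T} ⊆ {p : ℝ × ℝ | p.2 ∈ Icc 0 T} :=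
    fun p hp => Ioo_subset_Icc_self hp
  have h : IsStripSolution R T f u m :=
    ⟨hf, hf', hu.mono hopen, hm.mono hopen, fun x t ht => hpu x t (Ioo_subset_Icc_self ht),
      fun x t ht => hpm x t (Ioo_subset_Icc_self ht),
      fun x t ht => hpos x t (Ioo_subset_Icc_self ht),
      fun x t ht => hhj x t (Ioo_subset_Icc_self ht),
      fun x t ht => hcont x t (Ioo_subset_Icc_self ht)⟩
  have h0T : (0 : ℝ) ∈ Icc 0 T := ⟨le_rfl, hT.le⟩
  have hTT : T ∈ Icc 0 T := ⟨hT.le, le_rfl⟩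
  set B := 2 * max (⨆ x : ℝ, m x 0) (⨆ x : ℝ, m x T) with hB
  -- continuity and periodicity of the boundary quantities
  have hmc := hm.continuousOn
  have hfc : ContinuousOn (fun p : ℝ × ℝ => |f (m p.1 p.2)|) {p : ℝ × ℝ | p.2 ∈ Icc 0 T} :=
    (hf.continuousOn.comp hmc fun p hp => hpos p.1 p.2 hp).abs
  have hfxc : ContinuousOn (fun p : ℝ × ℝ => |deriv f (m p.1 p.2) * pdx m p.1 p.2|)
      {p : ℝ × ℝ | p.2 ∈ Icc 0 T} :=
    (((contDiffOn_deriv_of_two hf).continuousOn.comp hmc fun p hp => hpos p.1 p.2 hp).mul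
      (continuousOn_pdx_closed hT hm)).abs
  have hfp : ∀ x t, t ∈ Icc 0 T → |f (m (x + R) t)| = |f (m x t)| := fun x t ht => by
    rw [hpm x t ht]
  have hfxp : ∀ x t, t ∈ Icc 0 T →
      |deriv f (m (x + R) t) * pdx m (x + R) t| = |deriv f (m x t) * pdx m x t| :=
    fun x t ht => by rw [hpm x t ht, pdx_periodic hpm x t ht]
  have hdata : ∀ t ∈ Icc 0 T,
      ((⨆ x : ℝ, |f (m x t)|) + (⨆ x : ℝ, |deriv (fun y => f (m y t)) x|) ≤ M) →
      ∀ x, |f (m x t)| ≤ M ∧ |deriv f (m x t) * pdx m x t| ≤ M := by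
    intro t ht hMt x
    have hd : ∀ x, deriv (fun y => f (m y t)) x = deriv f (m x t) * pdx m x t := fun x =>
      ((hasDerivAt_of_contDiffOn_two hf (hpos x t ht)).comp (h := fun y => m y t) x
        (hasDerivAt_pdx_closed hm ht).differentiableAt.hasDerivAt).deriv
    simp only [hd] at hMt
    have h1 := le_ciSup (bddAbove_of_periodic (q := fun x t => |f (m x t)|) hR0 hfc hfp ht) x
    have h2 := le_ciSup (bddAbove_of_periodic
      (q := fun x t => |deriv f (m x t) * pdx m x t|) hR0 hfxc hfxp ht) x
    have h3 : 0 ≤ ⨆ x : ℝ, |f (m x t)| := Real.iSup_nonneg fun x => abs_nonneg _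
    have h4 : 0 ≤ ⨆ x : ℝ, |deriv f (m x t) * pdx m x t| := Real.iSup_nonneg fun x => abs_nonneg _
    exact ⟨by linarith, by linarith⟩
  have hmle : ∀ x t, t = 0 ∨ t = T → m x t < B := by
    have h0 := fun x => le_ciSup (bddAbove_of_periodic hR0 hmc hpm h0T) x
    have h1 := fun x => le_ciSup (bddAbove_of_periodic hR0 hmc hpm hTT) x
    have hmax : 0 < max (⨆ x : ℝ, m x 0) (⨆ x : ℝ, m x T) :=
      (hpos 0 0 h0T).trans_le ((h0 0).trans (le_max_left _ _))
    rintro x t (rfl | rfl)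
    · linarith [(h0 x).trans (le_max_left _ (⨆ x : ℝ, m x T))]
    · linarith [(h1 x).trans (le_max_right (⨆ x : ℝ, m x 0) _)]
  have hedge : ∀ t₀, t₀ = 0 ∨ t₀ = T → ∀ᶠ t in 𝓝[Icc 0 T] t₀, ∀ x,
      |f (m x t)| ≤ M + 1 ∧ |deriv f (m x t) * pdx m x t| ≤ M + 1 ∧ m x t ≤ B := by
    intro t₀ ht₀
    have hin : t₀ ∈ Icc 0 T := by rcases ht₀ with rfl | rfl <;> assumption
    have hd : ∀ x, |f (m x t₀)| ≤ M ∧ |deriv f (m x t₀) * pdx m x t₀| ≤ M := by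
      rcases ht₀ with rfl | rfl
      · exact hdata _ h0T hM0
      · exact hdata _ hTT hMT
    filter_upwards [
      eventually_forall_lt_of_periodic (q := fun x t => |f (m x t)|) (c := M + 1) hR0 hfc hfp hin
        (fun x => by linarith [(hd x).1]),
      eventually_forall_lt_of_periodic (q := fun x t => |deriv f (m x t) * pdx m x t|)
        (c := M + 1) hR0 hfxc hfxp hin (fun x => by linarith [(hd x).2]),
      eventually_forall_lt_of_periodic hR0 hmc hpm hin (fun x => hmle x t₀ ht₀)]
      with t h1 h2 h3 x using ⟨(h1 x).le, (h2 x).le, (h3 x).le⟩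
  have hf2 : ∀ s, 0 < s → s ≤ B → s * |deriv (deriv f) s| ≤ κ₀ * deriv f s := fun s hs hsB =>
    (div_le_iff₀ (hf' s hs)).1 (hκf s hs hsB).2
  have hint : ∀ x, ∀ t ∈ Ioo 0 T, |pdx u x t| ≤ W ∧ |f (m x t)| ≤ M + 1 := by
    intro x t ht
    have e0 : ∀ᶠ a in 𝓝[>] (0 : ℝ), a ∈ Ioo 0 (min t (T / 4)) ∧ ∀ x, |f (m x a)| ≤ M + 1 ∧
        |deriv f (m x a) * pdx m x a| ≤ M + 1 ∧ m x a ≤ B := by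
      refine Eventually.and (Ioo_mem_nhdsGT (lt_min ht.1 (by positivity))) ?_
      have := hedge 0 (Or.inl rfl)
      rw [nhdsWithin_Icc_eq_nhdsGE hT] at this
      exact this.filter_mono (nhdsWithin_mono _ Ioi_subset_Ici_self)
    have eT : ∀ᶠ b in 𝓝[<] T, b ∈ Ioo (max t (3 * T / 4)) T ∧ ∀ x, |f (m x b)| ≤ M + 1 ∧
        |deriv f (m x b) * pdx m x b| ≤ M + 1 ∧ m x b ≤ B := by
      refine Eventually.and (Ioo_mem_nhdsLT (max_lt ht.2 (by linarith))) ?_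
      have := hedge T (Or.inr rfl)
      rw [nhdsWithin_Icc_eq_nhdsLE hT] at this
      exact this.filter_mono (nhdsWithin_mono _ Iio_subset_Iic_self)
    obtain ⟨a, ha, hda⟩ := e0.exists
    obtain ⟨b, hb, hdb⟩ := eT.exists
    have ha1 := lt_min_iff.1 ha.2
    have hb1 := max_lt_iff.1 hb.1
    have hd : ∀ x, ∀ t, t = a ∨ t = b → |f (m x t)| ≤ M + 1 ∧
        |deriv f (m x t) * pdx m x t| ≤ M + 1 ∧ m x t ≤ B := by
      rintro x t (rfl | rfl)
      exacts [hda x, hdb x]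
    rw [hW]
    exact h.abs_pdx_le hR0 ha.1 (ha1.1.trans hb1.1) hb.2 (by linarith) (by linarith) hκ.le
      hK hA hV (fun x t ht => (hd x t ht).1) (fun x t ht => (hd x t ht).2.2)
      (fun x t ht => (hd x t ht).2.1) hf2 x t ⟨ha1.1.le, hb1.1.le⟩
  have hw := abs_le_closed_of_abs_le_open hT (continuousOn_pdx_closed hT hu)
    fun x t ht => (hint x t ht).1
  have hφ := abs_le_closed_of_abs_le_open (q := fun x t => f (m x t)) hT
    (hf.continuousOn.comp hmc fun p hp => hpos p.1 p.2 hp) fun x t ht => (hint x t ht).2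
  intro x t ht
  have h1 := hw x t ht
  have h2 := abs_le.1 (hφ x t ht)
  have h3 := hhj x t ht
  have h4 : pdx u x t ^ 2 ≤ W ^ 2 := sq_le_sq' (by linarith [(abs_le.1 h1).1]) (abs_le.1 h1).2
  have h5 : |pdt u x t| ≤ W ^ 2 / 2 + (M + 1) := abs_le.2
    ⟨by linarith [sq_nonneg (pdx u x t), sq_nonneg W], by linarith⟩
  linarith
end
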